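/- arXiv:1810.08128 — 6 statements merged into one kernel-verified Lean document; each statement's English description precedes it below -/
import Mathlib

section
/- Under Assumptions A1–A2, the system y_{t+1} = θ·f(y_t) + u_t + w_{t+1} is unstabilizable if there exist numbers δ, L, C > 0 and l₀ ≥ 3 such that for every l ≥ l₀ and every x ∈ ℝ, ℓ(S_4^L ∩ [x−l, x+l]) ≤ C·l/(log(log l))^{1+δ}, where S_4^L = {x ∈ ℝ : |f(x)| < L·x⁴}. -/
open MeasureTheory ProbabilityTheory Filter

namespace Unstab
open scoped ENNReal

/-- Rotation invariance of the planar standard Gaussian. -/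
lemma gauss_rot (t : ℝ) (G : ℝ × ℝ → ℝ≥0∞) (hG : Measurable G) :
    ∫⁻ x, ∫⁻ z, G (x, z) ∂(gaussianReal 0 1) ∂(gaussianReal 0 1)
      = ∫⁻ Y, ∫⁻ X, G ((t * Y + X) / √(1 + t ^ 2), (Y - t * X) / √(1 + t ^ 2))
          ∂(gaussianReal 0 1) ∂(gaussianReal 0 1) := by
  have hrot : ((gaussianReal 0 1).prod (gaussianReal 0 1)).map
      (ContinuousLinearMap.rotation (E := ℝ) (Real.arctan t))
        = (gaussianReal 0 1).prod (gaussianReal 0 1) := by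
    apply IsGaussian.map_rotation_eq_self_of_forall_strongDual_eq_zero
    intro L
    rw [IsGaussian.integral_dual]
    simp
  have h1 : ∫⁻ x, ∫⁻ z, G (x, z) ∂(gaussianReal 0 1) ∂(gaussianReal 0 1)
      = ∫⁻ p, G p ∂((gaussianReal 0 1).prod (gaussianReal 0 1)) := by
    rw [lintegral_prod _ hG.aemeasurable]
  rw [h1, ← hrot, lintegral_map hG (by fun_prop), lintegral_prod_symm]
  · refine lintegral_congr fun Y => lintegral_congr fun X => ?_
    congr 1
    rw [ContinuousLinearMap.rotation_apply]
    simp only [Real.cos_arctan, Real.sin_arctan, smul_eq_mul, Prod.mk.injEq]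
    constructor <;> ring
  · exact (hG.comp (by fun_prop)).aemeasurable

/-- One step of the Bayesian filter. -/
lemma filter_step {Ω α : Type*} [MeasurableSpace Ω] [MeasurableSpace α]
    (P : Measure Ω) [IsProbabilityMeasure P] (H : Ω → α) (hH : Measurable H)
    (θ W : Ω → ℝ) (hθ : Measurable θ) (hW : Measurable W)
    (hlaw : P.map W = gaussianReal 0 1)
    (hind : IndepFun (fun ω => (H ω, θ ω)) W P)
    (a b m s : α → ℝ) (ha : Measurable a) (hb : Measurable b) (hm : Measurable m)
    (hs : Measurable s)
    (inv : ∀ F : α × ℝ → ℝ≥0∞, Measurable F →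
      ∫⁻ ω, F (H ω, θ ω) ∂P = ∫⁻ ω, ∫⁻ x, F (H ω, m (H ω) + s (H ω) * x) ∂(gaussianReal 0 1) ∂P)
    (Φ : α × ℝ × ℝ → ℝ≥0∞) (hΦ : Measurable Φ) :
    ∫⁻ ω, Φ (H ω, θ ω * a (H ω) + b (H ω) + W ω, θ ω) ∂P
      = ∫⁻ ω, ∫⁻ Y, ∫⁻ X, Φ (H ω,
          m (H ω) * a (H ω) + b (H ω) + √(1 + (s (H ω) * a (H ω)) ^ 2) * Y,
          m (H ω) + s (H ω) * (s (H ω) * a (H ω)) / √(1 + (s (H ω) * a (H ω)) ^ 2) * Y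
            + s (H ω) / √(1 + (s (H ω) * a (H ω)) ^ 2) * X)
          ∂(gaussianReal 0 1) ∂(gaussianReal 0 1) ∂P := by
  have hpair : Measurable (fun ω => (H ω, θ ω)) := by fun_prop
  have hjoint := (indepFun_iff_map_prod_eq_prod_map_map hpair.aemeasurable hW.aemeasurable).1 hind
  let Ψ : (α × ℝ) × ℝ → ℝ≥0∞ := fun q => Φ (q.1.1, q.1.2 * a q.1.1 + b q.1.1 + q.2, q.1.2)
  have hΨ : Measurable Ψ := hΦ.comp (by fun_prop)
  have e1 : ∫⁻ ω, Φ (H ω, θ ω * a (H ω) + b (H ω) + W ω, θ ω) ∂P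
      = ∫⁻ q, Ψ q ∂(P.map (fun ω => ((H ω, θ ω), W ω))) := by
    rw [lintegral_map hΨ (by fun_prop)]
  rw [e1, hjoint, hlaw, lintegral_prod _ hΨ.aemeasurable, lintegral_map hΨ.lintegral_prod_right' hpair]
  rw [inv (fun q => ∫⁻ z, Ψ (q, z) ∂(gaussianReal 0 1)) hΨ.lintegral_prod_right']
  refine lintegral_congr fun ω => ?_
  generalize H ω = h
  rw [gauss_rot (s h * a h) (fun p => Ψ ((h, m h + s h * p.1), p.2)) (hΨ.comp (by fun_prop))]
  refine lintegral_congr fun Y => lintegral_congr fun X => ?_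
  have hpos : 0 < √(1 + (s h * a h) ^ 2) := by positivity
  have hsq : √(1 + (s h * a h) ^ 2) ^ 2 = 1 + (s h * a h) ^ 2 := Real.sq_sqrt (by positivity)
  simp only [Ψ]
  set t := s h * a h with ht
  set σ := √(1 + t ^ 2) with hσ
  have e2 : m h + s h * ((t * Y + X) / σ) = m h + s h * t / σ * Y + s h / σ * X := by
    field_simp
    ring
  have e3 : (m h + s h * ((t * Y + X) / σ)) * a h + b h + (Y - t * X) / σ
      = m h * a h + b h + σ * Y := by
    have : (m h + s h * ((t * Y + X) / σ)) * a h + b h + (Y - t * X) / σ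
        = m h * a h + b h + ((s h * a h) * (t * Y + X) + (Y - t * X)) / σ := by
      field_simp
      ring
    rw [this, ← ht, show t * (t * Y + X) + (Y - t * X) = (1 + t ^ 2) * Y by ring, ← hsq]
    field_simp
  rw [e2] at *
  rw [e3]

/-- The filter precision. -/
noncomputable def prec (f : ℝ → ℝ) (c : ℝ) (n : ℕ) (h : Fin (n + 1) → ℝ) : ℝ :=
  c + ∑ i : Fin n, f (h i.castSucc) ^ 2

lemma measurable_prec (f : ℝ → ℝ) (hf : Measurable f) (c : ℝ) (n : ℕ) :
    Measurable (prec f c n) := by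
  unfold prec
  fun_prop

lemma prec_snoc (f : ℝ → ℝ) (c : ℝ) (n : ℕ) (h : Fin (n + 1) → ℝ) (y : ℝ) :
    prec f c (n + 1) (Fin.snoc (α := fun _ => ℝ) h y) = prec f c n h + f (h (Fin.last n)) ^ 2 := by
  unfold prec
  rw [Fin.sum_univ_castSucc]
  simp only [Fin.snoc_castSucc]
  ring

lemma prec_pos (f : ℝ → ℝ) (c : ℝ) (hc : 0 < c) (n : ℕ) (h : Fin (n + 1) → ℝ) :
    0 < prec f c n h := by
  unfold prec
  positivity

lemma measurable_snoc (n : ℕ) : Measurable (fun p : (Fin (n + 1) → ℝ) × ℝ =>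
    (Fin.snoc (α := fun _ => ℝ) p.1 p.2 : Fin (n + 1 + 1) → ℝ)) := by
  refine measurable_pi_iff.2 fun i => ?_
  refine Fin.lastCases ?_ (fun j => ?_) i
  · simpa using measurable_snd
  · simp only [Fin.snoc_castSucc]
    fun_prop

/-- Assembling independence. -/
lemma indep_assoc {Ω α β γ : Type*} [MeasurableSpace Ω] [MeasurableSpace α] [MeasurableSpace β]
    [MeasurableSpace γ] (P : Measure Ω) [IsProbabilityMeasure P]
    (X : Ω → α) (U : Ω → β) (V : Ω → γ) (hX : Measurable X) (hU : Measurable U) (hV : Measurable V)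
    (h1 : IndepFun X (fun ω => (U ω, V ω)) P) (h2 : IndepFun U V P) :
    IndepFun (fun ω => (X ω, U ω)) V P := by
  have hXU : IndepFun X U P := h1.comp (φ := id) (ψ := Prod.fst) measurable_id measurable_fst
  rw [indepFun_iff_map_prod_eq_prod_map_map (by fun_prop) (by fun_prop)] at h1 h2 hXU ⊢
  have := Measure.isProbabilityMeasure_map (μ := P) hX.aemeasurable
  have := Measure.isProbabilityMeasure_map (μ := P) hU.aemeasurable
  have := Measure.isProbabilityMeasure_map (μ := P) hV.aemeasurable
  rw [hXU, ← MeasurableEquiv.prodAssoc.map_measurableEquiv_injective.eq_iff,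
    Measure.map_map (by fun_prop) (by fun_prop)]
  have := Measure.prodAssoc_prod (μ := P.map X) (ν := P.map U) (τ := P.map V)
  rw [this, ← h2, ← h1]
  rfl


lemma hist_succ {Ω : Type*} (y : ℕ → Ω → ℝ) (n : ℕ) (ω : Ω) :
    (fun i : Fin (n + 1 + 1) => y i ω) =
      Fin.snoc (α := fun _ => ℝ) (fun i : Fin (n + 1) => y i ω) (y (n + 1) ω) := by
  funext i
  refine Fin.lastCases ?_ (fun j => ?_) i
  · simp
  · simp

lemma hist_rep {Ω : Type*}
    (f : ℝ → ℝ) (hf : Measurable f)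
    (θ : Ω → ℝ)
    (w : ℕ → Ω → ℝ)
    (g : (t : ℕ) → (Fin (t + 1) → ℝ) → ℝ) (hg : ∀ t, Measurable (g t))
    (y : ℕ → Ω → ℝ) (y₀ : ℝ) (hy0 : ∀ ω, y 0 ω = y₀)
    (hy : ∀ t ω, y (t + 1) ω = θ ω * f (y t ω) + g t (fun i => y i ω) + w (t + 1) ω)
    (n : ℕ) : ∃ Ψ : ℝ × (Finset.range n → ℝ) → (Fin (n + 1) → ℝ), Measurable Ψ ∧
    ∀ ω, (fun i : Fin (n + 1) => y i ω) = Ψ (θ ω, fun i => w (i + 1) ω) := by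
  induction n with
  | zero =>
    refine ⟨fun _ _ => y₀, measurable_const, fun ω => ?_⟩
    funext i
    have : i = 0 := Subsingleton.elim (α := Fin 1) _ _
    subst this
    simpa using hy0 ω
  | succ n ih =>
    obtain ⟨Ψ, hΨ, hrep⟩ := ih
    let r : (Finset.range (n + 1) → ℝ) → (Finset.range n → ℝ) := fun u i =>
      u ⟨i.1, Finset.mem_range.2 (Nat.lt_succ_of_lt (Finset.mem_range.1 i.2))⟩
    have hr : Measurable r := by
      refine measurable_pi_iff.2 fun i => ?_
      exact measurable_pi_apply _
    let A : ℝ × (Finset.range (n + 1) → ℝ) → (Fin (n + 1) → ℝ) := fun p => Ψ (p.1, r p.2)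
    have hA : Measurable A := hΨ.comp (by fun_prop)
    have hlast : Measurable (fun p : ℝ × (Finset.range (n + 1) → ℝ) => p.2 ⟨n, by simp⟩) :=
      (measurable_pi_apply _).comp measurable_snd
    have hAl : Measurable (fun p => A p (Fin.last n)) := (measurable_pi_apply _).comp hA
    refine ⟨fun p => Fin.snoc (α := fun _ => ℝ) (A p)
      (p.1 * f (A p (Fin.last n)) + g n (A p) + p.2 ⟨n, by simp⟩), ?_, fun ω => ?_⟩
    · refine (measurable_snoc n).comp (hA.prodMk ?_)
      exact ((measurable_fst.mul (hf.comp hAl)).add ((hg n).comp hA)).add hlast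
    · have hAω : A (θ ω, fun i => w (i + 1) ω) = fun i : Fin (n + 1) => y i ω := (hrep ω).symm
      rw [hist_succ, hy]
      simp only [hAω]
      simp

lemma hist_meas {Ω : Type*} [MeasurableSpace Ω]
    (f : ℝ → ℝ) (hf : Measurable f)
    (θ : Ω → ℝ) (hθm : Measurable θ)
    (w : ℕ → Ω → ℝ) (hwm : ∀ t, Measurable (w t))
    (g : (t : ℕ) → (Fin (t + 1) → ℝ) → ℝ) (hg : ∀ t, Measurable (g t))
    (y : ℕ → Ω → ℝ) (y₀ : ℝ) (hy0 : ∀ ω, y 0 ω = y₀)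
    (hy : ∀ t ω, y (t + 1) ω = θ ω * f (y t ω) + g t (fun i => y i ω) + w (t + 1) ω)
    (n : ℕ) : Measurable (fun ω => (fun i : Fin (n + 1) => y i ω)) := by
  obtain ⟨Ψ, hΨ, hrep⟩ := hist_rep f hf θ w g hg y y₀ hy0 hy n
  have : (fun ω => (fun i : Fin (n + 1) => y i ω)) = fun ω => Ψ (θ ω, fun i => w (i + 1) ω) :=
    funext hrep
  rw [this]
  fun_prop

lemma hist_indep {Ω : Type*} [MeasurableSpace Ω] (P : Measure Ω) [IsProbabilityMeasure P]
    (f : ℝ → ℝ) (hf : Measurable f)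
    (θ : Ω → ℝ) (hθm : Measurable θ)
    (w : ℕ → Ω → ℝ) (hwm : ∀ t, Measurable (w t))
    (g : (t : ℕ) → (Fin (t + 1) → ℝ) → ℝ) (hg : ∀ t, Measurable (g t))
    (y : ℕ → Ω → ℝ) (y₀ : ℝ) (hy0 : ∀ ω, y 0 ω = y₀)
    (hy : ∀ t ω, y (t + 1) ω = θ ω * f (y t ω) + g t (fun i => y i ω) + w (t + 1) ω)
    (hw_indep : iIndepFun (fun t : ℕ => w (t + 1)) P)
    (hθw : IndepFun θ (fun ω (t : ℕ) => w (t + 1) ω) P) (n : ℕ) :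
    IndepFun (fun ω => ((fun i : Fin (n + 1) => y i ω), θ ω)) (w (n + 1)) P := by
  obtain ⟨Ψ, hΨ, hrep⟩ := hist_rep f hf θ w g hg y y₀ hy0 hy n
  have h2 : IndepFun (fun ω (i : Finset.range n) => w (i + 1) ω) (w (n + 1)) P := by
    have := hw_indep.indepFun_finset (Finset.range n) {n} (by simp) (fun i => hwm _)
    exact this.comp (φ := id) (ψ := fun u : (({n} : Finset ℕ) → ℝ) => u ⟨n, by simp⟩)
      measurable_id (measurable_pi_apply _)
  have h1 : IndepFun θ (fun ω => ((fun (i : Finset.range n) => w (i + 1) ω), w (n + 1) ω)) P := by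
    exact hθw.comp (φ := id) (ψ := fun u : ℕ → ℝ => ((fun (i : Finset.range n) => u i), u n))
      measurable_id (by fun_prop)
  have h3 := indep_assoc P θ _ (w (n + 1)) hθm (by fun_prop) (hwm _) h1 h2
  have := h3.comp (φ := fun p => (Ψ p, p.1)) (ψ := id) (by fun_prop) measurable_id
  have e : (fun ω => ((fun i : Fin (n + 1) => y i ω), θ ω)) =
      (fun p => (Ψ p, p.1)) ∘ fun ω => (θ ω, fun (i : Finset.range n) => w (i + 1) ω) := by
    funext ω
    simp [hrep ω]
  rw [e]
  exact this


lemma posterior {Ω : Type*} [MeasurableSpace Ω] (P : Measure Ω) [IsProbabilityMeasure P]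
    (f : ℝ → ℝ) (hf : Measurable f)
    (θ : Ω → ℝ) (hθm : Measurable θ)
    (w : ℕ → Ω → ℝ) (hwm : ∀ t, Measurable (w t))
    (g : (t : ℕ) → (Fin (t + 1) → ℝ) → ℝ) (hg : ∀ t, Measurable (g t))
    (y : ℕ → Ω → ℝ) (y₀ : ℝ) (hy0 : ∀ ω, y 0 ω = y₀)
    (hy : ∀ t ω, y (t + 1) ω = θ ω * f (y t ω) + g t (fun i => y i ω) + w (t + 1) ω)
    (θ₀ : ℝ) (P₀ : NNReal) (hP₀ : 0 < P₀)
    (hw_gauss : ∀ t : ℕ, Measure.map (w (t + 1)) P = gaussianReal 0 1)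
    (hw_indep : iIndepFun (fun t : ℕ => w (t + 1)) P)
    (hθ_gauss : Measure.map θ P = gaussianReal θ₀ P₀)
    (hθw : IndepFun θ (fun ω (t : ℕ) => w (t + 1) ω) P)
    (n : ℕ) : ∃ m : (Fin (n + 1) → ℝ) → ℝ, Measurable m ∧
    ∀ F : (Fin (n + 1) → ℝ) × ℝ → ℝ≥0∞, Measurable F →
      ∫⁻ ω, F (fun i => y i ω, θ ω) ∂P = ∫⁻ ω, ∫⁻ x, F (fun i => y i ω, m (fun i => y i ω) +
        (√(prec f (P₀ : ℝ)⁻¹ n (fun i => y i ω)))⁻¹ * x) ∂(gaussianReal 0 1) ∂P := by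
  have hc : 0 < (P₀ : ℝ)⁻¹ := by positivity
  induction n with
  | zero =>
    refine ⟨fun _ => θ₀, measurable_const, fun F hF => ?_⟩
    have e : ∀ ω, (fun i : Fin (0 + 1) => y i ω) = fun _ => y₀ := fun ω => by
      funext i
      have : i = 0 := Subsingleton.elim (α := Fin 1) _ _
      subst this
      simpa using hy0 ω
    have hsd : gaussianReal θ₀ P₀ = (gaussianReal 0 1).map (fun x => θ₀ + √(P₀ : ℝ) * x) := by
      have : (fun x : ℝ => θ₀ + √(P₀ : ℝ) * x) = (fun x => θ₀ + x) ∘ (fun x => √(P₀ : ℝ) * x) := rfl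
      rw [this, ← Measure.map_map (by fun_prop) (by fun_prop), gaussianReal_map_const_mul,
        gaussianReal_map_const_add]
      congr 1
      · simp
      · ext; simp
    simp_rw [e]
    rw [lintegral_const, measure_univ, mul_one]
    have hF' : Measurable (fun x : ℝ => F (fun _ => y₀, x)) := hF.comp (by fun_prop)
    rw [← lintegral_map hF' hθm, hθ_gauss, hsd, lintegral_map hF' (by fun_prop)]
    simp [prec]
  | succ n ih =>
    obtain ⟨m, hm, inv⟩ := ih
    have hH := hist_meas f hf θ hθm w hwm g hg y y₀ hy0 hy n
    have hind := hist_indep P f hf θ hθm w hwm g hg y y₀ hy0 hy hw_indep hθw n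
    let s : (Fin (n + 1) → ℝ) → ℝ := fun h => (√(prec f (P₀ : ℝ)⁻¹ n h))⁻¹
    let a : (Fin (n + 1) → ℝ) → ℝ := fun h => f (h (Fin.last n))
    have hpm := measurable_prec f hf (P₀ : ℝ)⁻¹ n
    have hs : Measurable s := by fun_prop
    have ha : Measurable a := by fun_prop
    have hgn := hg n
    have step := filter_step P _ hH θ (w (n + 1)) hθm (hwm _) (hw_gauss n) hind a (g n) m s ha
      (hg n) hm hs inv
    let init : (Fin (n + 1 + 1) → ℝ) → (Fin (n + 1) → ℝ) := fun h i => h i.castSucc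
    have hinit : Measurable init := by
      refine measurable_pi_iff.2 fun i => measurable_pi_apply _
    let m' : (Fin (n + 1 + 1) → ℝ) → ℝ := fun h =>
      m (init h) + s (init h) * (s (init h) * a (init h)) / (1 + (s (init h) * a (init h)) ^ 2)
        * (h (Fin.last (n + 1)) - (m (init h) * a (init h) + g n (init h)))
    have hm' : Measurable m' := by fun_prop
    refine ⟨m', hm', fun F hF => ?_⟩
    have hpm' := measurable_prec f hf (P₀ : ℝ)⁻¹ (n + 1)
    have hsn := measurable_snoc n
    let sn : (Fin (n + 1) → ℝ) → ℝ → (Fin (n + 1 + 1) → ℝ) := fun h z =>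
      Fin.snoc (α := fun _ => ℝ) h z
    have hyω : ∀ ω, (fun i : Fin (n + 1 + 1) => y i ω) = sn (fun i : Fin (n + 1) => y i ω)
        (θ ω * a (fun i : Fin (n + 1) => y i ω) + g n (fun i : Fin (n + 1) => y i ω)
          + w (n + 1) ω) := fun ω => by
      rw [hist_succ, hy]
      simp [sn, a]
    let K : (Fin (n + 1 + 1) → ℝ) → ℝ≥0∞ := fun h =>
      ∫⁻ x, F (h, m' h + (√(prec f (P₀ : ℝ)⁻¹ (n + 1) h))⁻¹ * x) ∂(gaussianReal 0 1)
    have hK : Measurable K := by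
      have : Measurable (fun p : (Fin (n + 1 + 1) → ℝ) × ℝ =>
        F (p.1, m' p.1 + (√(prec f (P₀ : ℝ)⁻¹ (n + 1) p.1))⁻¹ * p.2)) := hF.comp (by fun_prop)
      exact this.lintegral_prod_right'
    have A1 := step (fun q => F (sn q.1 q.2.1, q.2.2))
      (hF.comp ((hsn.comp (by fun_prop : Measurable fun q : (Fin (n + 1) → ℝ) × ℝ × ℝ =>
        (q.1, q.2.1))).prodMk (by fun_prop)))
    have A2 := step (fun q => K (sn q.1 q.2.1))
      (hK.comp (hsn.comp (by fun_prop : Measurable fun q : (Fin (n + 1) → ℝ) × ℝ × ℝ =>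
        (q.1, q.2.1))))
    change _ = ∫⁻ ω, K (fun i => y i ω) ∂P
    simp_rw [hyω]
    rw [A1, A2]
    refine lintegral_congr fun ω => lintegral_congr fun Y => ?_
    generalize (fun i : Fin (n + 1) => y i ω) = h
    simp only []
    rw [lintegral_const, measure_univ, mul_one]
    simp only [K]
    refine lintegral_congr fun X => ?_
    have hσ : 0 < √(1 + (s h * a h) ^ 2) := by positivity
    have hsq : √(1 + (s h * a h) ^ 2) ^ 2 = 1 + (s h * a h) ^ 2 := Real.sq_sqrt (by positivity)
    have hpp := prec_pos f (P₀ : ℝ)⁻¹ hc n h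
    have hin : ∀ z, init (sn h z) = h := fun z => by
      funext i
      simp [init, sn]
    have hla : ∀ z, sn h z (Fin.last (n + 1)) = z := fun z => by simp [sn]
    congr 3
    · simp only [m', hin, hla]
      rw [add_sub_cancel_left]
      have aux : ∀ t σ : ℝ, 0 < σ → σ ^ 2 = 1 + t ^ 2 →
          m h + s h * t / σ * Y = m h + s h * t / (1 + t ^ 2) * (σ * Y) := by
        intro t σ h1 h2
        rw [← h2]
        field_simp
      exact aux _ _ hσ hsq
    · simp only [sn]
      rw [prec_snoc]
      congr 1
      rw [div_eq_mul_inv]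
      simp only [s]
      rw [← mul_inv, ← Real.sqrt_mul hpp.le]
      congr 2
      rw [mul_pow, inv_pow, Real.sq_sqrt hpp.le]
      simp only [a]
      clear * - hpp
      generalize prec f (P₀ : ℝ)⁻¹ n h = r at hpp ⊢
      field_simp

/-- Conditional law of the next output. -/
lemma predictive {Ω : Type*} [MeasurableSpace Ω] (P : Measure Ω) [IsProbabilityMeasure P]
    (f : ℝ → ℝ) (hf : Measurable f)
    (θ : Ω → ℝ) (hθm : Measurable θ)
    (w : ℕ → Ω → ℝ) (hwm : ∀ t, Measurable (w t))
    (g : (t : ℕ) → (Fin (t + 1) → ℝ) → ℝ) (hg : ∀ t, Measurable (g t))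
    (y : ℕ → Ω → ℝ) (y₀ : ℝ) (hy0 : ∀ ω, y 0 ω = y₀)
    (hy : ∀ t ω, y (t + 1) ω = θ ω * f (y t ω) + g t (fun i => y i ω) + w (t + 1) ω)
    (θ₀ : ℝ) (P₀ : NNReal) (hP₀ : 0 < P₀)
    (hw_gauss : ∀ t : ℕ, Measure.map (w (t + 1)) P = gaussianReal 0 1)
    (hw_indep : iIndepFun (fun t : ℕ => w (t + 1)) P)
    (hθ_gauss : Measure.map θ P = gaussianReal θ₀ P₀)
    (hθw : IndepFun θ (fun ω (t : ℕ) => w (t + 1) ω) P)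
    (n : ℕ) : ∃ μ : (Fin (n + 1) → ℝ) → ℝ,
    ∀ F : (Fin (n + 1) → ℝ) × ℝ → ℝ≥0∞, Measurable F →
      ∫⁻ ω, F (fun i => y i ω, y (n + 1) ω) ∂P = ∫⁻ ω, ∫⁻ x, F (fun i => y i ω, μ (fun i => y i ω) +
        √(1 + f (y n ω) ^ 2 / (prec f (P₀ : ℝ)⁻¹ n (fun i => y i ω))) * x)
          ∂(gaussianReal 0 1) ∂P := by
  have hc : 0 < (P₀ : ℝ)⁻¹ := by positivity
  obtain ⟨m, hm, inv⟩ := posterior P f hf θ hθm w hwm g hg y y₀ hy0 hy θ₀ P₀ hP₀ hw_gauss hw_indep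
    hθ_gauss hθw n
  have hH := hist_meas f hf θ hθm w hwm g hg y y₀ hy0 hy n
  have hind := hist_indep P f hf θ hθm w hwm g hg y y₀ hy0 hy hw_indep hθw n
  let s : (Fin (n + 1) → ℝ) → ℝ := fun h => (√(prec f (P₀ : ℝ)⁻¹ n h))⁻¹
  let a : (Fin (n + 1) → ℝ) → ℝ := fun h => f (h (Fin.last n))
  have hpm := measurable_prec f hf (P₀ : ℝ)⁻¹ n
  have hs : Measurable s := by fun_prop
  have ha : Measurable a := by fun_prop
  have step := filter_step P _ hH θ (w (n + 1)) hθm (hwm _) (hw_gauss n) hind a (g n) m s ha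
      (hg n) hm hs inv
  refine ⟨fun h => m h * a h + g n h, fun F hF => ?_⟩
  have A := step (fun q => F (q.1, q.2.1)) (hF.comp (by fun_prop))
  have e : ∀ ω, y (n + 1) ω = θ ω * a (fun i : Fin (n + 1) => y i ω)
      + g n (fun i : Fin (n + 1) => y i ω) + w (n + 1) ω := fun ω => by
    rw [hy]; simp [a]
  simp_rw [e]
  rw [A]
  refine lintegral_congr fun ω => lintegral_congr fun Y => ?_
  simp only []
  rw [lintegral_const, measure_univ, mul_one]
  have hpp := prec_pos f (P₀ : ℝ)⁻¹ hc n (fun i => y i ω)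
  congr 5
  rw [mul_pow]
  simp only [s, a]
  rw [inv_pow, Real.sq_sqrt hpp.le]
  simp
  field_simp

end Unstab

namespace Unstab
open scoped ENNReal

lemma gauss_pdf_le (x : ℝ) : gaussianPDFReal 0 1 x ≤ (1 / 2) * Real.exp (-(x ^ 2 / 2)) := by
  rw [gaussianPDFReal_def]
  simp only [NNReal.coe_one, mul_one, sub_zero]
  have h2 : (2 : ℝ) ≤ √(2 * Real.pi) := by
    apply Real.le_sqrt_of_sq_le
    nlinarith [Real.pi_gt_three]
  have h3 : (√(2 * Real.pi))⁻¹ ≤ 1 / 2 := by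
    rw [one_div]
    exact inv_anti₀ (by norm_num) h2
  rw [neg_div]
  gcongr

lemma gauss_small (ε : ℝ) (hε : 0 < ε) (μ σ : ℝ) (hσ : 0 < σ) :
    gaussianReal 0 1 {x | |μ + σ * x| < ε * σ} ≤ ENNReal.ofReal ε := by
  have hsub : {x : ℝ | |μ + σ * x| < ε * σ} ⊆ Set.Icc (-μ / σ - ε) (-μ / σ + ε) := by
    intro x hx
    have hx0 : |μ + σ * x| < ε * σ := hx
    have hx' := abs_lt.1 hx0
    have e : μ + σ * x = σ * (x - (-μ / σ)) := by field_simp; ring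
    rw [e] at hx'
    constructor
    · have : σ * (-ε) < σ * (x - -μ / σ) := by linarith [hx'.1]
      have := lt_of_mul_lt_mul_left this hσ.le
      linarith
    · have : σ * (x - -μ / σ) < σ * ε := by linarith [hx'.2]
      have := lt_of_mul_lt_mul_left this hσ.le
      linarith
  refine (measure_mono hsub).trans ?_
  rw [gaussianReal_apply _ one_ne_zero]
  calc ∫⁻ x in Set.Icc (-μ / σ - ε) (-μ / σ + ε), gaussianPDF 0 1 x
      ≤ ∫⁻ x in Set.Icc (-μ / σ - ε) (-μ / σ + ε), ENNReal.ofReal (1 / 2) := by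
        refine lintegral_mono fun x => ?_
        rw [gaussianPDF_def]
        refine ENNReal.ofReal_le_ofReal ((gauss_pdf_le x).trans ?_)
        have : Real.exp (-(x ^ 2 / 2)) ≤ 1 := Real.exp_le_one_iff.2 (by nlinarith [sq_nonneg x])
        linarith
    _ = ENNReal.ofReal ε := by
        rw [setLIntegral_const, Real.volume_Icc, ← ENNReal.ofReal_mul (by norm_num)]
        congr 1
        ring

/-- Constant in the sparse set estimate. -/
lemma gauss_sum_finite : ∑' k : ℕ, ENNReal.ofReal (Real.exp (-((k : ℝ) ^ 2 / 2)) * (k + 1)) ≠ ∞ := by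
  have hs : Summable (fun k : ℕ => Real.exp (-(1 / 2 : ℝ)) ^ k * ((k : ℝ) + 1)) := by
    have hr : ‖Real.exp (-(1 / 2 : ℝ))‖ < 1 := by
      rw [Real.norm_eq_abs, abs_of_pos (Real.exp_pos _)]
      exact Real.exp_lt_one_iff.2 (by norm_num)
    have h1 := summable_pow_mul_geometric_of_norm_lt_one 1 hr
    have h0 := summable_pow_mul_geometric_of_norm_lt_one 0 hr
    refine (h1.add h0).congr fun k => ?_
    simp
    ring
  have hs2 : Summable (fun k : ℕ => Real.exp (-((k : ℝ) ^ 2 / 2)) * (k + 1)) := by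
    refine Summable.of_nonneg_of_le (fun k => by positivity) (fun k => ?_) hs
    rw [← Real.exp_nat_mul]
    gcongr
    have : (k : ℝ) ≤ (k : ℝ) ^ 2 := by exact_mod_cast Nat.le_self_pow (by norm_num) k
    linarith
  exact hs2.tsum_ofReal_ne_top

lemma gauss_sparse (S : Set ℝ) (hS : MeasurableSet S) (μ σ B : ℝ) (hσ : 0 < σ)
    (h : ∀ r : ℝ, 1 ≤ r → (volume (S ∩ Set.Icc (μ - r * σ) (μ + r * σ))).toReal ≤ B * (r * σ)) :
    gaussianReal 0 1 {x | μ + σ * x ∈ S} ≤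
      (∑' k : ℕ, ENNReal.ofReal (Real.exp (-((k : ℝ) ^ 2 / 2)) * (k + 1))) * ENNReal.ofReal B := by
  set A : Set ℝ := {x | μ + σ * x ∈ S} with hA
  have hAm : MeasurableSet A := hS.preimage (by fun_prop : Measurable fun x : ℝ => μ + σ * x)
  have hvol : ∀ r : ℝ, 1 ≤ r → volume (A ∩ Set.Icc (-r) r) ≤ ENNReal.ofReal (B * r) := by
    intro r hr
    have e : A ∩ Set.Icc (-r) r =
        (fun x => σ * x) ⁻¹' ((fun x => μ + x) ⁻¹' (S ∩ Set.Icc (μ - r * σ) (μ + r * σ))) := by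
      ext x
      simp only [hA, Set.mem_inter_iff, Set.mem_ofPred_eq, Set.mem_Icc, Set.mem_preimage]
      refine and_congr_right fun _ => and_congr ?_ ?_
      · constructor
        · intro hx; nlinarith
        · intro hx
          have : σ * (-r) ≤ σ * x := by linarith
          exact le_of_mul_le_mul_left this hσ
      · constructor
        · intro hx; nlinarith
        · intro hx
          have : σ * x ≤ σ * r := by linarith
          exact le_of_mul_le_mul_left this hσ
    rw [e, Real.volume_preimage_mul_left hσ.ne', measure_preimage_add]
    have hfin : volume (S ∩ Set.Icc (μ - r * σ) (μ + r * σ)) ≠ ∞ :=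
      measure_ne_top_of_subset Set.inter_subset_right (by simp)
    rw [← ENNReal.ofReal_toReal hfin, ← ENNReal.ofReal_mul (abs_nonneg _)]
    refine ENNReal.ofReal_le_ofReal ?_
    rw [abs_of_pos (inv_pos.2 hσ)]
    calc σ⁻¹ * _ ≤ σ⁻¹ * (B * (r * σ)) := by
          gcongr
          exact h r hr
      _ = B * r := by field_simp
  rw [gaussianReal_apply _ one_ne_zero, ← lintegral_indicator hAm]
  have hpt : ∀ x, A.indicator (gaussianPDF 0 1) x ≤
      ∑' k : ℕ, ENNReal.ofReal (Real.exp (-((k : ℝ) ^ 2 / 2))) *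
        (A ∩ Set.Icc (-((k : ℝ) + 1)) ((k : ℝ) + 1)).indicator 1 x := by
    intro x
    by_cases hx : x ∈ A
    · refine le_trans ?_ (ENNReal.le_tsum ⌊|x|⌋₊)
      have h1 := Nat.floor_le (abs_nonneg x)
      have h2 := Nat.lt_floor_add_one |x|
      have hmem : x ∈ A ∩ Set.Icc (-((⌊|x|⌋₊ : ℝ) + 1)) ((⌊|x|⌋₊ : ℝ) + 1) :=
        ⟨hx, abs_le.1 h2.le⟩
      rw [Set.indicator_of_mem hx, Set.indicator_of_mem hmem, gaussianPDF_def]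
      simp only [Pi.one_apply, mul_one]
      refine ENNReal.ofReal_le_ofReal ((gauss_pdf_le x).trans ?_)
      have h3 : Real.exp (-(x ^ 2 / 2)) ≤ Real.exp (-((⌊|x|⌋₊ : ℝ) ^ 2 / 2)) := by
        apply Real.exp_le_exp.2
        have : (⌊|x|⌋₊ : ℝ) ^ 2 ≤ |x| ^ 2 := by gcongr
        rw [sq_abs] at this
        linarith
      linarith [Real.exp_pos (-(x ^ 2 / 2))]
    · rw [Set.indicator_of_notMem hx]
      exact zero_le
  refine (lintegral_mono hpt).trans ?_
  rw [lintegral_tsum]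
  · rw [← ENNReal.tsum_mul_right]
    refine ENNReal.tsum_le_tsum fun k => ?_
    rw [lintegral_const_mul _ (by
      exact (measurable_one).indicator (hAm.inter measurableSet_Icc)),
      lintegral_indicator_one (hAm.inter measurableSet_Icc)]
    refine (mul_le_mul_right (hvol (k + 1) (by linarith [(Nat.cast_nonneg k : (0 : ℝ) ≤ k)])) _).trans ?_
    rw [← ENNReal.ofReal_mul (by positivity), ← ENNReal.ofReal_mul (by positivity)]
    refine ENNReal.ofReal_le_ofReal (le_of_eq ?_)
    ring
  · intro k
    exact (((measurable_one).indicator (hAm.inter measurableSet_Icc)).const_mul _).aemeasurable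

/-- Deterministic growth. -/
lemma growth (a : ℕ → ℝ) (c A : ℝ) (hA : 0 ≤ A) (hc : 0 ≤ c) (N : ℕ)
    (h0 : A + 2 * c ≤ a 1 - 2 * a 0)
    (ha0 : 2 * |a 0| ≤ A)
    (hstep : ∀ n < N, 4 * (a (n + 1) - a n) - c * (n + 1) ≤ a (n + 2)) :
    A / 2 * 2 ^ N ≤ a (N + 1) - a N := by
  have hD : ∀ n ≤ N, A * 2 ^ n + c * (n + 2) ≤ a (n + 1) - 2 * a n := by
    intro n
    induction n with
    | zero => intro _; simp; linarith
    | succ n ih =>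
      intro hn
      have h1 := ih (by omega)
      have h2 := hstep n (by omega)
      push_cast
      rw [pow_succ]
      nlinarith
  have hL : ∀ n ≤ N, 2 ^ n * a 0 ≤ a n := by
    intro n
    induction n with
    | zero => intro _; simp
    | succ n ih =>
      intro hn
      have h1 := ih (by omega)
      have h2 := hD n (by omega)
      have : 0 ≤ A * 2 ^ n := by positivity
      have : 0 ≤ c * ((n : ℝ) + 2) := by positivity
      rw [pow_succ]
      nlinarith
  have h1 := hD N le_rfl
  have h2 := hL N le_rfl
  have : 0 ≤ c * ((N : ℝ) + 2) := by positivity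
  have h3 : - (A / 2) ≤ a 0 := by linarith [neg_abs_le (a 0)]
  have h4 : (2 : ℝ) ^ N * (- (A / 2)) ≤ 2 ^ N * a 0 := by gcongr
  linarith

lemma limsup_top (z : ℕ → ℝ) (h : ∀ n : ℕ, ((n : ℝ) + 1) ^ 2 ≤ (z (n + 1)) ^ 2) :
    Filter.limsup (fun t : ℕ =>
      (((∑ i ∈ Finset.Icc 1 t, (z i) ^ 2) / t : ℝ) : EReal)) Filter.atTop = ⊤ := by
  apply Tendsto.limsup_eq
  rw [EReal.tendsto_coe_nhds_top_iff]
  refine tendsto_atTop_mono' _ ?_ tendsto_natCast_atTop_atTop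
  filter_upwards [eventually_ge_atTop 1] with t ht
  obtain ⟨n, rfl⟩ : ∃ n, t = n + 1 := ⟨t - 1, by omega⟩
  have hpos : (0 : ℝ) < ((n + 1 : ℕ) : ℝ) := by positivity
  rw [le_div_iff₀ hpos]
  have h1 : (z (n + 1)) ^ 2 ≤ ∑ i ∈ Finset.Icc 1 (n + 1), (z i) ^ 2 :=
    Finset.single_le_sum (f := fun i => (z i) ^ 2) (fun i _ => sq_nonneg _) (by simp)
  have := h n
  push_cast
  nlinarith

lemma exists_start (S : Set ℝ) (δ C l₀ : ℝ) (hδ : 0 < δ)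
    (hsparse : ∀ l : ℝ, l₀ ≤ l → ∀ x : ℝ,
      (volume (S ∩ Set.Icc (x - l) (x + l))).toReal ≤
        C * l / (Real.log (Real.log l)) ^ ((1 : ℝ) + δ)) (M : ℝ) :
    ∃ y₀, M ≤ y₀ ∧ y₀ ∉ S := by
  have ht : Tendsto (fun l : ℝ => (Real.log (Real.log l)) ^ ((1 : ℝ) + δ)) atTop atTop :=
    (tendsto_rpow_atTop (by linarith)).comp (Real.tendsto_log_atTop.comp Real.tendsto_log_atTop)
  obtain ⟨l, hl1, hl2, hl3⟩ := ((ht.eventually_gt_atTop (max C 1)).and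
    ((eventually_ge_atTop l₀).and (eventually_gt_atTop (0 : ℝ)))).exists
  by_contra hcon
  push Not at hcon
  have hsub : S ∩ Set.Icc (M + l - l) (M + l + l) = Set.Icc (M + l - l) (M + l + l) := by
    refine Set.inter_eq_right.2 fun z hz => hcon z ?_
    linarith [hz.1]
  have := hsparse l hl2 (M + l)
  rw [hsub, Real.volume_Icc, ENNReal.toReal_ofReal (by linarith)] at this
  have hpos : 0 < Real.log (Real.log l) ^ ((1 : ℝ) + δ) :=
    lt_trans (lt_of_lt_of_le one_pos (le_max_right _ _)) hl1
  rw [le_div_iff₀ hpos] at this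
  have hC := lt_of_le_of_lt (le_max_left C 1) hl1
  nlinarith
end Unstab

namespace Unstab
open scoped ENNReal
/-- Precision along a path. -/
noncomputable def rr (f : ℝ → ℝ) (p : ℝ) (z : ℕ → ℝ) (n : ℕ) : ℝ :=
  p + ∑ i ∈ Finset.range n, f (z i) ^ 2

lemma rr_pos (f : ℝ → ℝ) (p : ℝ) (hp : 0 < p) (z : ℕ → ℝ) (n : ℕ) : 0 < rr f p z n := by
  unfold rr
  positivity

lemma rr_succ (f : ℝ → ℝ) (p : ℝ) (z : ℕ → ℝ) (n : ℕ) :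
    rr f p z (n + 1) = rr f p z n + f (z n) ^ 2 := by
  unfold rr
  rw [Finset.sum_range_succ]
  ring

/-- Predictive standard deviation along a path. -/
noncomputable def sg (f : ℝ → ℝ) (p : ℝ) (z : ℕ → ℝ) (n : ℕ) : ℝ :=
  √(1 + f (z n) ^ 2 / rr f p z n)

lemma sg_pos (f : ℝ → ℝ) (p : ℝ) (hp : 0 < p) (z : ℕ → ℝ) (n : ℕ) : 0 < sg f p z n := by
  unfold sg
  have := rr_pos f p hp z n
  positivity

lemma log_sg (f : ℝ → ℝ) (p : ℝ) (hp : 0 < p) (z : ℕ → ℝ) (n : ℕ) :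
    2 * Real.log (sg f p z n) = Real.log (rr f p z (n + 1)) - Real.log (rr f p z n) := by
  have h1 := rr_pos f p hp z n
  have h2 := rr_pos f p hp z (n + 1)
  have e : 1 + f (z n) ^ 2 / rr f p z n = rr f p z (n + 1) / rr f p z n := by
    rw [rr_succ]
    field_simp
  unfold sg
  rw [e, Real.log_sqrt (by positivity), Real.log_div h2.ne' h1.ne']
  ring

lemma log_rr_ge (f : ℝ → ℝ) (p : ℝ) (hp : 0 < p) (L : ℝ) (hL : 0 < L) (z : ℕ → ℝ) (n : ℕ)
    (hz : 0 < |z n|) (hf : L * z n ^ 4 ≤ |f (z n)|) :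
    2 * Real.log L + 8 * Real.log |z n| ≤ Real.log (rr f p z (n + 1)) := by
  have h1 := rr_pos f p hp z n
  have e : 2 * Real.log L + 8 * Real.log |z n| = Real.log ((L * |z n| ^ 4) ^ 2) := by
    rw [Real.log_pow, Real.log_mul hL.ne' (by positivity), Real.log_pow]
    push_cast
    ring
  rw [e]
  apply Real.log_le_log (by positivity)
  rw [rr_succ, ← sq_abs (f (z n))]
  have e4 : |z n| ^ 4 = z n ^ 4 := by
    rw [show |z n| ^ 4 = (|z n| ^ 2) ^ 2 by ring, sq_abs]; ring
  have : (L * |z n| ^ 4) ^ 2 ≤ |f (z n)| ^ 2 := by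
    rw [e4]
    have : 0 ≤ L * z n ^ 4 := by positivity
    gcongr
  linarith

/-- The good event at step `n`. -/
def good (f : ℝ → ℝ) (L p : ℝ) (z : ℕ → ℝ) (n : ℕ) : Prop :=
  L * z (n + 1) ^ 4 ≤ |f (z (n + 1))| ∧ (1 / 2) ^ (n + 3) * sg f p z n ≤ |z (n + 1)|

lemma log_good (f : ℝ → ℝ) (p : ℝ) (hp : 0 < p) (L : ℝ) (z : ℕ → ℝ) (n : ℕ)
    (h : good f L p z n) :
    0 < |z (n + 1)| ∧ Real.log (sg f p z n) - (n + 3) ≤ Real.log |z (n + 1)| := by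
  have hs := sg_pos f p hp z n
  have hpos : 0 < (1 / 2 : ℝ) ^ (n + 3) * sg f p z n := by positivity
  refine ⟨hpos.trans_le h.2, ?_⟩
  have := Real.log_le_log hpos h.2
  rw [Real.log_mul (by positivity) hs.ne', Real.log_pow, one_div, Real.log_inv] at this
  have h2 : Real.log 2 ≤ 1 := by linarith [Real.log_two_lt_d9]
  push_cast at this
  nlinarith [(Nat.cast_nonneg n : (0 : ℝ) ≤ n)]

lemma path_growth (f : ℝ → ℝ) (p : ℝ) (hp : 0 < p) (L : ℝ) (hL : 0 < L) (A : ℝ)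
    (hA : 2 * |Real.log p| ≤ A) (z : ℕ → ℝ) (hz0 : 0 < z 0) (hf0 : L * z 0 ^ 4 ≤ |f (z 0)|)
    (h0 : A + 2 * (2 * |Real.log L| + 24) + 2 * Real.log p - 2 * Real.log L ≤ 8 * Real.log (z 0))
    (N : ℕ) (hgood : ∀ n < N, good f L p z n) :
    A / 4 * 2 ^ N ≤ Real.log (sg f p z N) := by
  have hr0 : rr f p z 0 = p := by simp [rr]
  have hA0 : 0 ≤ A := le_trans (by positivity) hA
  have := growth (fun n => Real.log (rr f p z n)) (2 * |Real.log L| + 24) A hA0 (by positivity) N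
    (by
      have := log_rr_ge f p hp L hL z 0 (abs_pos.2 hz0.ne') hf0
      rw [abs_of_pos hz0] at this
      simp only [hr0]
      simp only [zero_add] at this
      linarith)
    (by simpa only [hr0] using hA)
    (by
      intro n hn
      obtain ⟨h1, h2⟩ := log_good f p hp L z n (hgood n hn)
      have h3 := log_rr_ge f p hp L hL z (n + 1) h1 (hgood n hn).1
      have h4 := log_sg f p hp z n
      have h5 := neg_abs_le (Real.log L)
      have h6 : 0 ≤ |Real.log L| * n := by positivity
      have h7 : (0 : ℝ) ≤ n := Nat.cast_nonneg n
      rw [← h4]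
      nlinarith)
  have h4 := log_sg f p hp z N
  beta_reduce at this
  rw [← h4] at this
  linarith

lemma path_large (f : ℝ → ℝ) (p : ℝ) (hp : 0 < p) (L : ℝ) (A : ℝ) (hA : 16 ≤ A) (z : ℕ → ℝ) (n : ℕ)
    (hs : A / 4 * 2 ^ n ≤ Real.log (sg f p z n)) (hg : good f L p z n) :
    ((n : ℝ) + 1) ^ 2 ≤ z (n + 1) ^ 2 := by
  obtain ⟨h1, h2⟩ := log_good f p hp L z n hg
  have h3 : (n : ℝ) + 1 ≤ 2 ^ n := by exact_mod_cast Nat.lt_two_pow_self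
  have h4 : (n : ℝ) ≤ Real.log |z (n + 1)| := by
    have : 4 * ((n : ℝ) + 1) ≤ A / 4 * 2 ^ n := by
      have h8 : (4 : ℝ) ≤ A / 4 := by linarith
      gcongr
    linarith [(Nat.cast_nonneg n : (0 : ℝ) ≤ n)]
  have h5 : (n : ℝ) + 1 ≤ |z (n + 1)| := by
    calc (n : ℝ) + 1 ≤ Real.exp n := Real.add_one_le_exp _
      _ ≤ Real.exp (Real.log |z (n + 1)|) := Real.exp_le_exp.2 h4
      _ = _ := Real.exp_log h1
  rw [← sq_abs (z (n + 1))]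
  gcongr
end Unstab
namespace Unstab
open scoped ENNReal

/-- The constant of the Gaussian shell sum. -/
noncomputable def KK : ℝ≥0∞ :=
  ∑' k : ℕ, ENNReal.ofReal (Real.exp (-((k : ℝ) ^ 2 / 2)) * (k + 1))

/-- The sparsity bound at step `n`. -/
noncomputable def BB (C δ : ℝ) (m : ℕ) : ℝ := C / ((m : ℝ) / 2) ^ ((1 : ℝ) + δ)

lemma sparse_step (S : Set ℝ) (δ C l₀ : ℝ) (hδ : 0 < δ) (hC : 0 < C)
    (hsparse : ∀ l : ℝ, l₀ ≤ l → ∀ x : ℝ,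
      (volume (S ∩ Set.Icc (x - l) (x + l))).toReal ≤
        C * l / (Real.log (Real.log l)) ^ ((1 : ℝ) + δ))
    (N n : ℕ) (hN : 1 ≤ N) (hNl : l₀ ≤ N) (l : ℝ)
    (hl : Real.exp (Real.exp N * 2 ^ n) ≤ l) (x : ℝ) :
    (volume (S ∩ Set.Icc (x - l) (x + l))).toReal ≤ BB C δ (n + N) * l := by
  have hN1 : (1 : ℝ) ≤ N := by exact_mod_cast hN
  have hn0 : (0 : ℝ) ≤ n := Nat.cast_nonneg n
  have h1 : (1 : ℝ) ≤ 2 ^ n := one_le_pow₀ (by norm_num)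
  have e1 : (N : ℝ) ≤ Real.exp N * 2 ^ n := by
    nlinarith [Real.add_one_le_exp (N : ℝ), Real.exp_pos (N : ℝ)]
  have e2 : (N : ℝ) ≤ l := by
    linarith [Real.add_one_le_exp (Real.exp N * 2 ^ n)]
  have hlpos : 0 < l := (Real.exp_pos _).trans_le hl
  have hlog : Real.exp N * 2 ^ n ≤ Real.log l := (Real.le_log_iff_exp_le hlpos).2 hl
  have hpos : 0 < Real.exp (N : ℝ) * 2 ^ n := by positivity
  have hll : ((n + N : ℕ) : ℝ) / 2 ≤ Real.log (Real.log l) := by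
    have := Real.log_le_log hpos hlog
    rw [Real.log_mul (Real.exp_pos _).ne' (by positivity), Real.log_exp, Real.log_pow] at this
    have h2 := Real.log_two_gt_d9
    push_cast
    nlinarith
  refine (hsparse l (hNl.trans e2) x).trans ?_
  have hh : 0 < ((n + N : ℕ) : ℝ) / 2 := by push_cast; linarith
  unfold BB
  rw [div_mul_eq_mul_div]
  have := Real.rpow_le_rpow hh.le hll (by linarith : (0 : ℝ) ≤ 1 + δ)
  have := Real.rpow_pos_of_pos hh (1 + δ)
  gcongr

lemma prec_eq_rr (f : ℝ → ℝ) (p : ℝ) (z : ℕ → ℝ) (n : ℕ) :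
    prec f p n (fun i => z i) = rr f p z n := by
  unfold prec rr
  rw [← Fin.sum_univ_eq_sum_range (fun i => f (z i) ^ 2) n]
  simp

lemma bad_prob {Ω : Type*} [MeasurableSpace Ω] (P : Measure Ω) [IsProbabilityMeasure P]
    (f : ℝ → ℝ) (hf : Measurable f)
    (θ : Ω → ℝ) (hθm : Measurable θ)
    (w : ℕ → Ω → ℝ) (hwm : ∀ t, Measurable (w t))
    (θ₀ : ℝ) (P₀ : NNReal) (hP₀ : 0 < P₀)
    (hw_gauss : ∀ t : ℕ, Measure.map (w (t + 1)) P = gaussianReal 0 1)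
    (hw_indep : iIndepFun (fun t : ℕ => w (t + 1)) P)
    (hθ_gauss : Measure.map θ P = gaussianReal θ₀ P₀)
    (hθw : IndepFun θ (fun ω (t : ℕ) => w (t + 1) ω) P)
    (δ L C l₀ : ℝ) (hδ : 0 < δ) (hC : 0 < C)
    (hsparse : ∀ l : ℝ, l₀ ≤ l → ∀ x : ℝ,
      (volume ({z : ℝ | |f z| < L * z ^ 4} ∩ Set.Icc (x - l) (x + l))).toReal ≤
        C * l / (Real.log (Real.log l)) ^ ((1 : ℝ) + δ))
    (g : (t : ℕ) → (Fin (t + 1) → ℝ) → ℝ) (hg : ∀ t, Measurable (g t))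
    (y₀ : ℝ) (y : ℕ → Ω → ℝ) (hy0 : ∀ ω, y 0 ω = y₀)
    (hy : ∀ t ω, y (t + 1) ω = θ ω * f (y t ω) + g t (fun i => y i ω) + w (t + 1) ω)
    (N n : ℕ) (hN : 1 ≤ N) (hNl : l₀ ≤ N) :
    P {ω | Real.exp (Real.exp N * 2 ^ n) ≤ sg f (P₀ : ℝ)⁻¹ (fun i => y i ω) n ∧
      ¬ good f L (P₀ : ℝ)⁻¹ (fun i => y i ω) n} ≤
      ENNReal.ofReal ((1 / 2) ^ (n + 3)) + KK * ENNReal.ofReal (BB C δ (n + N)) := by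
  set S : Set ℝ := {z : ℝ | |f z| < L * z ^ 4} with hSdef
  have hS : MeasurableSet S := measurableSet_lt (by fun_prop) (by fun_prop)
  have hc : 0 < (P₀ : ℝ)⁻¹ := by positivity
  obtain ⟨μ, hμ⟩ := predictive P f hf θ hθm w hwm g hg y y₀ hy0 hy θ₀ P₀ hP₀ hw_gauss hw_indep
    hθ_gauss hθw n
  have hH := hist_meas f hf θ hθm w hwm g hg y y₀ hy0 hy n
  have hH' : Measurable (y (n + 1)) := by
    have := hist_meas f hf θ hθm w hwm g hg y y₀ hy0 hy (n + 1)
    have h2 := (measurable_pi_apply (Fin.last (n + 1))).comp this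
    simpa [Function.comp_def] using h2
  have hpm := measurable_prec f hf (P₀ : ℝ)⁻¹ n
  let s : (Fin (n + 1) → ℝ) → ℝ := fun h =>
    √(1 + f (h (Fin.last n)) ^ 2 / prec f (P₀ : ℝ)⁻¹ n h)
  have hs : Measurable s := by fun_prop
  have hss : ∀ ω, s (fun i => y i ω) = sg f (P₀ : ℝ)⁻¹ (fun i => y i ω) n := by
    intro ω
    simp only [s, sg]
    rw [prec_eq_rr f _ (fun i => y i ω) n]
    simp
  set T := Real.exp (Real.exp N * 2 ^ n) with hT
  let E : Set ((Fin (n + 1) → ℝ) × ℝ) :=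
    {q | T ≤ s q.1} ∩ ((fun q => q.2) ⁻¹' S ∪ {q | |q.2| < (1 / 2) ^ (n + 3) * s q.1})
  have hE : MeasurableSet E := by
    refine (measurableSet_le (by fun_prop) (by fun_prop)).inter
      ((measurable_snd hS).union (measurableSet_lt (by fun_prop) (by fun_prop)))
  have hEm : Measurable (E.indicator (1 : (Fin (n + 1) → ℝ) × ℝ → ℝ≥0∞)) :=
    measurable_one.indicator hE
  have hpair : Measurable (fun ω => ((fun i : Fin (n + 1) => y i ω), y (n + 1) ω)) :=
    hH.prodMk hH'
  have key := hμ _ hEm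
  have hL : P {ω | T ≤ sg f (P₀ : ℝ)⁻¹ (fun i => y i ω) n ∧
      ¬ good f L (P₀ : ℝ)⁻¹ (fun i => y i ω) n} =
      ∫⁻ ω, E.indicator (1 : (Fin (n + 1) → ℝ) × ℝ → ℝ≥0∞)
        ((fun i : Fin (n + 1) => y i ω), y (n + 1) ω) ∂P := by
    have : (fun ω => E.indicator (1 : (Fin (n + 1) → ℝ) × ℝ → ℝ≥0∞)
        ((fun i : Fin (n + 1) => y i ω), y (n + 1) ω)) =
        ((fun ω => ((fun i : Fin (n + 1) => y i ω), y (n + 1) ω)) ⁻¹' E).indicator 1 := by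
      ext ω
      rfl
    rw [this, lintegral_indicator_one (hpair hE)]
    congr 1
    ext ω
    have e1 : (((fun i : Fin (n + 1) => y i ω), y (n + 1) ω) ∈ E) ↔
      (T ≤ s (fun i => y i ω) ∧ (|f (y (n + 1) ω)| < L * y (n + 1) ω ^ 4 ∨
        |y (n + 1) ω| < (1 / 2) ^ (n + 3) * s (fun i => y i ω))) := Iff.rfl
    rw [Set.mem_preimage, e1, hss, Set.mem_ofPred_eq]
    unfold good
    rw [not_and_or, not_le, not_le]
  rw [hL, key]
  calc _ ≤ ∫⁻ ω, (ENNReal.ofReal ((1 / 2) ^ (n + 3)) + KK * ENNReal.ofReal (BB C δ (n + N))) ∂P := by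
        refine lintegral_mono fun ω => ?_
        set σ := √(1 + f (y n ω) ^ 2 / (prec f (P₀ : ℝ)⁻¹ n (fun i => y i ω))) with hσd
        have hsσ : s (fun i => y i ω) = σ := by
          simp only [s, hσd, Fin.val_last]
        set m := μ (fun i => y i ω)
        by_cases hTs : T ≤ σ
        · have hσ : 0 < σ := (Real.exp_pos _).trans_le hTs
          have hle : ∀ x, E.indicator (1 : (Fin (n + 1) → ℝ) × ℝ → ℝ≥0∞)
              ((fun i : Fin (n + 1) => y i ω), m + σ * x) ≤
              ({x | |m + σ * x| < (1 / 2) ^ (n + 3) * σ} ∪ {x | m + σ * x ∈ S}).indicator 1 x := by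
            intro x
            by_cases hx : ((fun i : Fin (n + 1) => y i ω), m + σ * x) ∈ E
            · have hx2 : m + σ * x ∈ S ∨ |m + σ * x| < (1 / 2) ^ (n + 3) * s (fun i => y i ω) := hx.2
              rw [hsσ] at hx2
              have hx3 : x ∈ {x | |m + σ * x| < (1 / 2) ^ (n + 3) * σ} ∪ {x | m + σ * x ∈ S} :=
                hx2.symm
              rw [Set.indicator_of_mem hx, Set.indicator_of_mem hx3]
              simp
            · rw [Set.indicator_of_notMem hx]
              exact zero_le
          refine (lintegral_mono hle).trans ?_
          refine (lintegral_indicator_one_le _).trans ?_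
          refine (measure_union_le _ _).trans ?_
          refine add_le_add (gauss_small _ (by positivity) m σ hσ)
            (gauss_sparse S hS m σ _ hσ ?_)
          intro r hr
          apply sparse_step S δ C l₀ hδ hC hsparse N n hN hNl (r * σ)
          nlinarith
        · have hz : ∀ x, E.indicator (1 : (Fin (n + 1) → ℝ) × ℝ → ℝ≥0∞)
              ((fun i : Fin (n + 1) => y i ω), m + σ * x) = 0 := by
            intro x
            apply Set.indicator_of_notMem
            intro hx
            have hx1 : T ≤ s (fun i => y i ω) := hx.1
            rw [hsσ] at hx1
            exact hTs hx1
          simp only [hz, lintegral_zero]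
          exact zero_le
    _ = _ := by simp

lemma choose_N (δ C a b : ℝ) (hδ : 0 < δ) (hC : 0 < C) :
    ∃ N : ℕ, 4 ≤ N ∧ a ≤ N ∧ b ≤ N ∧
      ∑' n : ℕ, KK * ENNReal.ofReal (BB C δ (n + N)) < 1 / 4 := by
  have hsum : Summable (BB C δ) := by
    have h := (Real.summable_one_div_nat_rpow (p := 1 + δ)).2 (by linarith)
    have h2 := h.mul_left (C * 2 ^ (1 + δ))
    refine h2.congr fun m => ?_
    unfold BB
    rw [Real.div_rpow (by positivity) (by norm_num)]
    field_simp
  have hnn : ∀ m, 0 ≤ BB C δ m := fun m => by unfold BB; positivity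
  have hne : ∑' m, KK * ENNReal.ofReal (BB C δ m) ≠ ∞ := by
    rw [ENNReal.tsum_mul_left]
    refine ENNReal.mul_ne_top gauss_sum_finite ?_
    rw [← ENNReal.ofReal_tsum_of_nonneg hnn hsum]
    exact ENNReal.ofReal_ne_top
  have ht := ENNReal.tendsto_sum_nat_add _ hne
  have h4 : (0 : ℝ≥0∞) < 1 / 4 := by simp
  obtain ⟨N, h1, h2, h3, h5⟩ := ((eventually_ge_atTop 4).and
    ((tendsto_natCast_atTop_atTop.eventually_ge_atTop a).and
      ((tendsto_natCast_atTop_atTop.eventually_ge_atTop b).and (ht.eventually_lt_const h4)))).exists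
  exact ⟨N, h1, h2, h3, h5⟩

lemma half_sum : ∑' n : ℕ, ENNReal.ofReal ((1 / 2) ^ (n + 3)) = ENNReal.ofReal (1 / 4) := by
  have hs : Summable (fun n : ℕ => (1 / 2 : ℝ) ^ (n + 3)) := by
    simp_rw [pow_add]
    exact summable_geometric_two.mul_right _
  rw [← ENNReal.ofReal_tsum_of_nonneg (fun n => by positivity) hs]
  congr 1
  simp_rw [pow_add]
  rw [tsum_mul_right, tsum_geometric_two]
  norm_num

end Unstab

open Unstab in
/-- Theorem 3: under A1–A2, the system `y (t+1) = θ f (y t) + u t + w (t+1)` is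
unstabilizable if for some `δ, L, C > 0` and `l₀ ≥ 3`, for every `l ≥ l₀` and every `x`,
`ℓ(S_4^L ∩ [x-l, x+l]) ≤ C l / (log log l)^{1+δ}`, where `S_4^L = {x : |f x| < L x⁴}`. -/
theorem stmt_2
    {Ω : Type*} [MeasurableSpace Ω] (P : Measure Ω) [IsProbabilityMeasure P]
    (f : ℝ → ℝ) (hf : Measurable f)
    (θ : Ω → ℝ) (hθm : Measurable θ)
    (w : ℕ → Ω → ℝ) (hwm : ∀ t, Measurable (w t))
    (θ₀ : ℝ) (P₀ : NNReal) (hP₀ : 0 < P₀)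
    (hw_gauss : ∀ t : ℕ, Measure.map (w (t + 1)) P = gaussianReal 0 1)
    (hw_indep : iIndepFun (fun t : ℕ => w (t + 1)) P)
    (hθ_gauss : Measure.map θ P = gaussianReal θ₀ P₀)
    (hθw : IndepFun θ (fun ω (t : ℕ) => w (t + 1) ω) P)
    (δ L C l₀ : ℝ) (hδ : 0 < δ) (hL : 0 < L) (hC : 0 < C) (hl₀ : 3 ≤ l₀)
    (hsparse : ∀ l : ℝ, l₀ ≤ l → ∀ x : ℝ,
      (volume ({z : ℝ | |f z| < L * z ^ 4} ∩ Set.Icc (x - l) (x + l))).toReal ≤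
        C * l / (Real.log (Real.log l)) ^ ((1 : ℝ) + δ)) :
    ∀ g : (t : ℕ) → (Fin (t + 1) → ℝ) → ℝ, (∀ t, Measurable (g t)) →
      ∃ y₀ : ℝ, ∀ y : ℕ → Ω → ℝ,
        (∀ ω, y 0 ω = y₀) →
        (∀ t ω, y (t + 1) ω =
          θ ω * f (y t ω) + g t (fun i => y i ω) + w (t + 1) ω) →
        0 < P {ω | Filter.limsup (fun t : ℕ =>
          (((∑ i ∈ Finset.Icc 1 t, (y i ω) ^ 2) / t : ℝ) : EReal)) Filter.atTop = ⊤} := by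
  intro g hg
  have hp : 0 < (P₀ : ℝ)⁻¹ := by positivity
  set p : ℝ := (P₀ : ℝ)⁻¹ with hpdef
  obtain ⟨N, hN4, hNl, hNp, hNsum⟩ := choose_N δ C l₀ |Real.log p| hδ hC
  have hN4' : (4 : ℝ) ≤ N := by exact_mod_cast hN4
  have hexp := Real.add_one_le_exp (N : ℝ)
  set A : ℝ := 4 * Real.exp N with hA
  obtain ⟨y₀, hM, hyS⟩ := exists_start {z : ℝ | |f z| < L * z ^ 4} δ C l₀ hδ hsparse
    (max 1 (Real.exp ((A + 2 * (2 * |Real.log L| + 24) + 2 * Real.log p - 2 * Real.log L) / 8)))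
  have hy₀pos : 0 < y₀ := lt_of_lt_of_le one_pos ((le_max_left _ _).trans hM)
  have hf0 : L * y₀ ^ 4 ≤ |f y₀| := by
    by_contra hcon
    exact hyS (lt_of_not_ge hcon)
  have hlog0 : A + 2 * (2 * |Real.log L| + 24) + 2 * Real.log p - 2 * Real.log L
      ≤ 8 * Real.log y₀ := by
    have := (Real.le_log_iff_exp_le hy₀pos).2 ((le_max_right _ _).trans hM)
    linarith
  refine ⟨y₀, fun y hy0 hy => ?_⟩
  have hgr : ∀ ω n, (∀ k < n, good f L p (fun i => y i ω) k) →
      A / 4 * 2 ^ n ≤ Real.log (sg f p (fun i => y i ω) n) := by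
    intro ω n h
    refine path_growth f p hp L hL A (by linarith) _ ?_ ?_ ?_ n h
    · simpa [hy0] using hy₀pos
    · simpa [hy0] using hf0
    · simpa [hy0] using hlog0
  let G : Set Ω := {ω | ∀ n, good f L p (fun i => y i ω) n}
  have hGsub : G ⊆ {ω | Filter.limsup (fun t : ℕ =>
          (((∑ i ∈ Finset.Icc 1 t, (y i ω) ^ 2) / t : ℝ) : EReal)) Filter.atTop = ⊤} := by
    intro ω hω
    have hω' : ∀ n, good f L p (fun i => y i ω) n := hω
    refine limsup_top (fun i => y i ω) fun n => ?_
    exact path_large f p hp L A (by linarith) (fun i => y i ω) n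
      (hgr ω n fun k _ => hω' k) (hω' n)
  have hbad : P Gᶜ ≤ ENNReal.ofReal (1 / 4) + 1 / 4 := by
    have hsub : Gᶜ ⊆ ⋃ n : ℕ, {ω | Real.exp (Real.exp N * 2 ^ n) ≤ sg f p (fun i => y i ω) n ∧
        ¬ good f L p (fun i => y i ω) n} := by
      intro ω hω
      have hω' : ¬ ∀ n, good f L p (fun i => y i ω) n := hω
      push Not at hω'
      classical
      have hfind := Nat.find_spec hω'
      have hmin : ∀ k < Nat.find hω', good f L p (fun i => y i ω) k := fun k hk =>
        not_not.1 (Nat.find_min hω' hk)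
      refine Set.mem_iUnion.2 ⟨Nat.find hω', ?_, hfind⟩
      have := hgr ω _ hmin
      rw [Real.le_log_iff_exp_le (sg_pos f p hp _ _)] at this
      rwa [show A / 4 = Real.exp N by rw [hA]; ring] at this
    refine (measure_mono hsub).trans ((measure_iUnion_le _).trans ?_)
    refine (ENNReal.tsum_le_tsum fun n => bad_prob P f hf θ hθm w hwm θ₀ P₀ hP₀ hw_gauss hw_indep
      hθ_gauss hθw δ L C l₀ hδ hC hsparse g hg y₀ y hy0 hy N n (by omega) hNl).trans ?_
    rw [ENNReal.tsum_add, half_sum]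
    gcongr
  have hlt : P Gᶜ < 1 := by
    refine hbad.trans_lt ?_
    rw [show (1 / 4 : ENNReal) = ENNReal.ofReal (1 / 4) by
      rw [ENNReal.ofReal_div_of_pos (by norm_num)]; norm_num,
      ← ENNReal.ofReal_add (by norm_num) (by norm_num)]
    rw [ENNReal.ofReal_lt_one]
    norm_num
  refine lt_of_lt_of_le ?_ (measure_mono hGsub)
  rw [pos_iff_ne_zero]
  intro h0
  have h1 : (1 : ENNReal) ≤ P G + P Gᶜ := by
    rw [← measure_univ (μ := P), ← Set.union_compl_self G]
    exact measure_union_le _ _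
  rw [h0, zero_add] at h1
  exact absurd hlt (not_lt.2 h1)
end

section
/- In the closed-loop least-squares setup, suppose that for some b ∈ ℝ and L > 0 the set S_b^L contains a nonempty open interval and liminf_{l→+∞} ℓ(S_b^L ∩ [−l, l])/l > 0. Then for every positive integer n, defining the events A_m^n := {y_{mn} ∈ S_b^L, y_{mn+1} ∈ S_b^L, …, y_{mn+n−1} ∈ S_b^L} for m ≥ 1, one has Σ_{m=1}^∞ 1_{A_m^n} = +∞ almost surely; that is, almost surely the events A_m^n occur for infinitely many m. -/
open MeasureTheory ProbabilityTheory Filter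

theorem aux_gauss (S : Set ℝ) (hS : MeasurableSet S)
    (hliminf : 0 < Filter.liminf (fun l : ℝ =>
      (volume (S ∩ Set.Icc (-l) l)).toReal / l) Filter.atTop) :
    ∃ δ : ℝ, 0 < δ ∧ δ ≤ 1 ∧ ∀ s : ℝ, 1 ≤ s →
      δ ≤ (2 * Real.pi * s) ^ (-(1 : ℝ) / 2) * ∫ x in S, Real.exp (-x ^ 2 / (2 * s)) := by
  obtain ⟨a, ha, ha0⟩ : ∃ a : ℝ, (∀ᶠ l : ℝ in atTop,
      a ≤ (volume (S ∩ Set.Icc (-l) l)).toReal / l) ∧ 0 < a := by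
    by_contra hcon
    push Not at hcon
    rw [Filter.liminf_eq] at hliminf
    exact absurd hliminf (not_lt.mpr (Real.sSup_nonpos (fun x hx => hcon x hx)))
  obtain ⟨l1, hl1⟩ := Filter.eventually_atTop.1 ha
  set l0 := max l1 1 with hl0
  have h1 : 1 ≤ l0 := le_max_right _ _
  have hpi := Real.pi_pos
  set δ := (2 * Real.pi) ^ (-(1 : ℝ) / 2) * (Real.exp (-l0 ^ 2 / 2) * (a * l0)) with hδ
  have hδ0 : 0 < δ := by positivity
  refine ⟨min δ 1, lt_min hδ0 one_pos, min_le_right _ _, fun s hs => (min_le_left _ _).trans ?_⟩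
  have hs0 : 0 < s := by linarith
  have hr : 1 ≤ √s := Real.one_le_sqrt.2 hs
  have hrs : √s ^ 2 = s := Real.sq_sqrt hs0.le
  set l := l0 * √s with hl
  have hll : l0 ≤ l := by nlinarith
  have hlpos : 0 < l := by linarith
  have hvol := hl1 l ((le_max_left _ _).trans hll)
  rw [le_div_iff₀ hlpos] at hvol
  have hint : Integrable (fun x : ℝ => Real.exp (-x ^ 2 / (2 * s))) := by
    have := integrable_exp_neg_mul_sq (b := 1 / (2 * s)) (by positivity)
    refine this.congr (Eventually.of_forall fun x => ?_)
    simp only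
    congr 1
    ring
  have hfin : volume (S ∩ Set.Icc (-l) l) ≠ ⊤ :=
    ((measure_mono Set.inter_subset_right).trans_lt measure_Icc_lt_top).ne
  have hI : Real.exp (-l0 ^ 2 / 2) * (a * l) ≤ ∫ x in S, Real.exp (-x ^ 2 / (2 * s)) := by
    calc Real.exp (-l0 ^ 2 / 2) * (a * l)
        ≤ Real.exp (-l0 ^ 2 / 2) * (volume (S ∩ Set.Icc (-l) l)).toReal := by gcongr
      _ ≤ ∫ x in S ∩ Set.Icc (-l) l, Real.exp (-x ^ 2 / (2 * s)) := by
          refine setIntegral_ge_of_const_le_real (hS.inter measurableSet_Icc) hfin ?_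
            hint.integrableOn
          intro x hx
          have hx2 : x ^ 2 ≤ l ^ 2 := sq_le_sq' hx.2.1 hx.2.2
          apply Real.exp_le_exp.2
          rw [div_le_div_iff₀ (by norm_num) (by positivity)]
          have : l ^ 2 = l0 ^ 2 * s := by rw [hl, mul_pow, hrs]
          nlinarith
      _ ≤ ∫ x in S, Real.exp (-x ^ 2 / (2 * s)) :=
          setIntegral_mono_set hint.integrableOn
            (Eventually.of_forall fun x => (Real.exp_pos _).le)
            (Eventually.of_forall Set.inter_subset_left)
  have hpow : (2 * Real.pi * s) ^ (-(1 : ℝ) / 2) = (2 * Real.pi) ^ (-(1 : ℝ) / 2) * (√s)⁻¹ := by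
    rw [Real.mul_rpow (by positivity) hs0.le, Real.sqrt_eq_rpow, ← Real.rpow_neg hs0.le]
    norm_num
  calc δ = (2 * Real.pi * s) ^ (-(1 : ℝ) / 2) * (Real.exp (-l0 ^ 2 / 2) * (a * l)) := by
        rw [hpow, hδ, hl]; field_simp
    _ ≤ _ := by gcongr

/-- Lemma 2: in the closed-loop least-squares setup, if `S_b^L` contains a nonempty open
interval and `liminf_{l→∞} ℓ(S_b^L ∩ [-l,l])/l > 0`, then for every `n ≥ 1`, almost surely
the events `A m n = {y (mn), …, y (mn+n-1) ∈ S_b^L}` occur for infinitely many `m ≥ 1`. -/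
theorem stmt_6
    {Ω : Type*} [MeasurableSpace Ω] (P : Measure Ω) [IsProbabilityMeasure P]
    (y : ℕ → Ω → ℝ) (hy : ∀ t, Measurable (y t))
    (f : ℝ → ℝ) (hf : Measurable f)
    (P₀ : ℝ) (hP₀ : 0 < P₀)
    (R σ2 : ℕ → Ω → ℝ)
    (hR : ∀ t ω, R t ω = P₀⁻¹ + ∑ i ∈ Finset.range t, (f (y i ω)) ^ 2)
    (hσ2 : ∀ t ω, σ2 t ω = R (t + 1) ω / R t ω)
    (𝔉 : ℕ → MeasurableSpace Ω)
    (h𝔉 : ∀ t, 𝔉 t = ⨆ i : Fin (t + 1), MeasurableSpace.comap (y i) inferInstance)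
    (hGauss : ∀ t : ℕ, ∀ A : Set ℝ, MeasurableSet A →
      (P[Set.indicator {ω | y (t + 1) ω ∈ A} (fun _ => (1 : ℝ))|𝔉 t]) =ᵐ[P]
        fun ω => (2 * Real.pi * σ2 t ω) ^ (-(1 : ℝ) / 2) *
          ∫ x in A, Real.exp (-x ^ 2 / (2 * σ2 t ω)))
    (b L : ℝ) (hL : 0 < L)
    (hint : ∃ u v : ℝ, u < v ∧ Set.Ioo u v ⊆ {x : ℝ | |f x| < L * |x| ^ b})
    (hliminf : 0 < Filter.liminf (fun l : ℝ =>
      (volume ({x : ℝ | |f x| < L * |x| ^ b} ∩ Set.Icc (-l) l)).toReal / l)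
      Filter.atTop) :
    ∀ n : ℕ, 0 < n → ∀ᵐ ω ∂P,
      {m : ℕ | 1 ≤ m ∧ ∀ j < n,
        |f (y (m * n + j) ω)| < L * |y (m * n + j) ω| ^ b}.Infinite := by
  intro n hn
  set S : Set ℝ := {x : ℝ | |f x| < L * |x| ^ b} with hSdef
  have hS : MeasurableSet S := by
    apply measurableSet_lt <;> fun_prop
  obtain ⟨δ, hδ0, hδ1, hδ⟩ := aux_gauss S hS hliminf
  have hRpos : ∀ t ω, 0 < R t ω := by
    intro t ω
    rw [hR]
    have : 0 ≤ ∑ i ∈ Finset.range t, (f (y i ω)) ^ 2 := Finset.sum_nonneg fun i _ => sq_nonneg _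
    positivity
  have hσ1 : ∀ t ω, 1 ≤ σ2 t ω := by
    intro t ω
    rw [hσ2, one_le_div (hRpos t ω), hR, hR, Finset.sum_range_succ]
    nlinarith [sq_nonneg (f (y t ω))]
  have hle : ∀ t, 𝔉 t ≤ ‹MeasurableSpace Ω› := by
    intro t
    rw [h𝔉]
    exact iSup_le fun i => (hy i).comap_le
  have hev : ∀ t i, i ≤ t → MeasurableSet[𝔉 t] {ω | y i ω ∈ S} := by
    intro t i hi
    rw [h𝔉]
    exact le_iSup (fun i : Fin (t + 1) => MeasurableSpace.comap (y i) inferInstance)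
      ⟨i, by omega⟩ _ ⟨S, hS, rfl⟩
  have hmono : ∀ s t, s ≤ t → 𝔉 s ≤ 𝔉 t := by
    intro s t hst
    rw [h𝔉, h𝔉]
    exact iSup_le fun i => le_iSup (fun i : Fin (t + 1) =>
      MeasurableSpace.comap (y i) inferInstance) ⟨i, by omega⟩
  -- one-step bound
  have hstep : ∀ t, ∀ B : Set Ω, MeasurableSet[𝔉 t] B →
      δ * P.real B ≤ P.real (B ∩ {ω | y (t + 1) ω ∈ S}) := by
    intro t B hB
    have hyS : MeasurableSet {ω | y (t + 1) ω ∈ S} := hy (t + 1) hS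
    have hi : Integrable (Set.indicator {ω | y (t + 1) ω ∈ S} (fun _ => (1 : ℝ))) P :=
      (integrable_const _).indicator hyS
    have h1 := setIntegral_condExp (hle t) hi hB
    have h2 : ∫ ω in B, Set.indicator {ω | y (t + 1) ω ∈ S} (fun _ => (1 : ℝ)) ω ∂P
        = P.real (B ∩ {ω | y (t + 1) ω ∈ S}) := by
      rw [setIntegral_indicator hyS]
      simp
    rw [← h2, ← h1]
    calc δ * P.real B = ∫ ω in B, δ ∂P := by simp [mul_comm]
      _ ≤ _ := by
        refine setIntegral_mono_ae (integrable_const _).integrableOn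
          integrable_condExp.integrableOn ?_
        filter_upwards [hGauss t S hS] with ω hω
        rw [hω]
        exact hδ _ (hσ1 t ω)
  have hm : ∀ t j, MeasurableSet[𝔉 (t + j)] {ω | ∀ i < j, y (t + 1 + i) ω ∈ S} := by
    intro t j
    have : {ω | ∀ i < j, y (t + 1 + i) ω ∈ S} = ⋂ i, ⋂ (_ : i < j), {ω | y (t + 1 + i) ω ∈ S} := by
      ext; simp
    rw [this]
    exact MeasurableSet.iInter fun i => MeasurableSet.iInter fun hi => hev _ _ (by omega)
  have hmulti : ∀ t, ∀ B : Set Ω, MeasurableSet[𝔉 t] B → ∀ j,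
      δ ^ j * P.real B ≤ P.real (B ∩ {ω | ∀ i < j, y (t + 1 + i) ω ∈ S}) := by
    intro t B hB j
    induction j with
    | zero => simp
    | succ j ih =>
      have h := hstep (t + j) _ ((hmono t (t + j) (by omega) _ hB).inter (hm t j))
      have he : B ∩ {ω | ∀ i < j, y (t + 1 + i) ω ∈ S} ∩ {ω | y (t + j + 1) ω ∈ S}
          = B ∩ {ω | ∀ i < j + 1, y (t + 1 + i) ω ∈ S} := by
        ext ω
        simp only [Set.mem_inter_iff, Set.mem_setOf_eq, and_assoc, Nat.lt_succ_iff_lt_or_eq,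
          or_imp, forall_and, forall_eq, show t + j + 1 = t + 1 + j by omega]
      rw [he] at h
      refine le_trans ?_ h
      rw [pow_succ', mul_assoc]
      gcongr
  -- blocks
  let A : ℕ → Set Ω := fun m => {ω | ∀ j < n, y (m * n + j) ω ∈ S}
  have hA : ∀ m, 1 ≤ m → ∃ t, t + 1 = m * n := fun m hm1 =>
    ⟨m * n - 1, Nat.sub_add_cancel (Nat.mul_pos hm1 hn)⟩
  have hnull : ∀ M, 1 ≤ M → P.real {ω | ∀ m ≥ M, ω ∉ A m} = 0 := by
    intro M hM
    let B : ℕ → Set Ω := fun k => {ω | ∀ i < k, ω ∉ A (M + i)}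
    have hBm : ∀ k t, t + 1 = (M + k) * n → MeasurableSet[𝔉 t] (B k) := by
      intro k t ht
      have : B k = ⋂ i, ⋂ (_ : i < k), ⋃ j, ⋃ (_ : j < n),
          {ω | y ((M + i) * n + j) ω ∈ S}ᶜ := by
        ext; simp [B, A]
      rw [this]
      refine MeasurableSet.iInter fun i => MeasurableSet.iInter fun hi =>
        MeasurableSet.iUnion fun j => MeasurableSet.iUnion fun hj => (hev _ _ ?_).compl
      have : (M + i + 1) * n ≤ (M + k) * n := Nat.mul_le_mul_right _ (by omega)
      rw [Nat.add_mul _ 1] at this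
      omega
    have hB : ∀ k, P.real (B k) ≤ (1 - δ ^ n) ^ k := by
      intro k
      induction k with
      | zero => simp [B]
      | succ k ih =>
        obtain ⟨t, ht⟩ := hA (M + k) (by omega)
        have h := hmulti t (B k) (hBm k t ht) n
        rw [ht] at h
        have hAm : MeasurableSet (A (M + k)) := by
          have := hle _ _ (hm t n)
          rw [ht] at this
          exact this
        have h3 := measureReal_inter_add_diff (μ := P) (s := B k) hAm
        have he : B (k + 1) = B k \ A (M + k) := by
          ext ω
          simp only [B, Set.mem_diff, Set.mem_setOf_eq, Nat.lt_succ_iff_lt_or_eq,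
            or_imp, forall_and, forall_eq]
        have h4 : (0:ℝ) ≤ 1 - δ ^ n := sub_nonneg.2 (pow_le_one₀ hδ0.le hδ1)
        rw [he, pow_succ']
        have h5 := mul_le_mul_of_nonneg_left ih h4
        change _ ≤ P.real (B k ∩ A (M + k)) at h
        linarith
    have hlim : Tendsto (fun k : ℕ => (1 - δ ^ n) ^ k) atTop (nhds 0) :=
      tendsto_pow_atTop_nhds_zero_of_lt_one (sub_nonneg.2 (pow_le_one₀ hδ0.le hδ1))
        (by linarith [pow_pos hδ0 n])
    refine le_antisymm (ge_of_tendsto' hlim fun k => ?_) measureReal_nonneg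
    refine (measureReal_mono ?_).trans (hB k)
    intro ω hω i _
    exact hω (M + i) (by simp)
  have hae : ∀ᵐ ω ∂P, ∀ M : ℕ, ∃ m ≥ M + 1, ω ∈ A m := by
    rw [ae_all_iff]
    intro M
    have := hnull (M + 1) (by omega)
    rw [measureReal_eq_zero_iff] at this
    rw [ae_iff]
    simpa using this
  filter_upwards [hae] with ω hω
  refine Set.infinite_of_forall_exists_gt fun M => ?_
  obtain ⟨m, hm1, hm2⟩ := hω M
  exact ⟨m, ⟨by omega, hm2⟩, by omega⟩
end

section
/- In the closed-loop least-squares setup, suppose there exist ρ ∈ ℝ and c₁ > 0 such that ℓ(S_b^L ∩ [ρ−l, ρ+l]) ≥ c₁·l for every l > 0. Then for every i ≥ 0, P(y_{i+1} ∈ S_b^L | 𝔉_i) ≥ (c₁/√(2π))·e^{−(1+|ρ|)²/2} almost surely. -/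
open MeasureTheory ProbabilityTheory Filter

/-- In the closed-loop least-squares setup, if `ℓ(S_b^L ∩ [ρ-l, ρ+l]) ≥ c₁ l` for all
`l > 0`, then for every `i`, `P(y (i+1) ∈ S_b^L | 𝔉 i) ≥ (c₁/√(2π)) e^{-(1+|ρ|)²/2}`
almost surely. -/
theorem stmt_7
    {Ω : Type*} [MeasurableSpace Ω] (P : Measure Ω) [IsProbabilityMeasure P]
    (y : ℕ → Ω → ℝ) (hy : ∀ t, Measurable (y t))
    (f : ℝ → ℝ) (hf : Measurable f)
    (P₀ : ℝ) (hP₀ : 0 < P₀)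
    (R σ2 : ℕ → Ω → ℝ)
    (hR : ∀ t ω, R t ω = P₀⁻¹ + ∑ i ∈ Finset.range t, (f (y i ω)) ^ 2)
    (hσ2 : ∀ t ω, σ2 t ω = R (t + 1) ω / R t ω)
    (𝔉 : ℕ → MeasurableSpace Ω)
    (h𝔉 : ∀ t, 𝔉 t = ⨆ i : Fin (t + 1), MeasurableSpace.comap (y i) inferInstance)
    (hGauss : ∀ t : ℕ, ∀ A : Set ℝ, MeasurableSet A →
      (P[Set.indicator {ω | y (t + 1) ω ∈ A} (fun _ => (1 : ℝ))|𝔉 t]) =ᵐ[P]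
        fun ω => (2 * Real.pi * σ2 t ω) ^ (-(1 : ℝ) / 2) *
          ∫ x in A, Real.exp (-x ^ 2 / (2 * σ2 t ω)))
    (b L : ℝ) (hL : 0 < L) (ρ c₁ : ℝ) (hc₁ : 0 < c₁)
    (hlow : ∀ l : ℝ, 0 < l →
      c₁ * l ≤ (volume ({x : ℝ | |f x| < L * |x| ^ b} ∩ Set.Icc (ρ - l) (ρ + l))).toReal) :
    ∀ i : ℕ, ∀ᵐ ω ∂P,
      c₁ / Real.sqrt (2 * Real.pi) * Real.exp (-(1 + |ρ|) ^ 2 / 2) ≤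
        (P[Set.indicator {ω' | |f (y (i + 1) ω')| < L * |y (i + 1) ω'| ^ b}
            (fun _ => (1 : ℝ))|𝔉 i]) ω := by
  intro i
  have hS : MeasurableSet {x : ℝ | |f x| < L * |x| ^ b} := by
    apply measurableSet_lt
    · exact hf.abs
    · exact (measurable_id.abs.pow_const b).const_mul L
  filter_upwards [hGauss i _ hS] with ω hω
  rw [hω]
  have hRpos : 0 < R i ω := by
    rw [hR]
    have : 0 ≤ ∑ j ∈ Finset.range i, (f (y j ω)) ^ 2 := Finset.sum_nonneg fun _ _ => sq_nonneg _
    have := inv_pos.mpr hP₀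
    linarith
  have hv : 1 ≤ σ2 i ω := by
    rw [hσ2, le_div_iff₀ hRpos, hR (i + 1), hR i, Finset.sum_range_succ]
    nlinarith [sq_nonneg (f (y i ω))]
  generalize σ2 i ω = v at hv
  obtain ⟨s, hs, rfl⟩ : ∃ s : ℝ, 1 ≤ s ∧ v = s ^ 2 :=
    ⟨Real.sqrt v, by rw [Real.one_le_sqrt]; exact hv, (Real.sq_sqrt (by linarith)).symm⟩
  have hs0 : 0 < s := by linarith
  set S := {x : ℝ | |f x| < L * |x| ^ b} with hSdef
  set K := Real.exp (-(1 + |ρ|) ^ 2 / 2) with hK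
  have hK0 : 0 < K := Real.exp_pos _
  have hint : Integrable (fun x : ℝ => Real.exp (-x ^ 2 / (2 * s ^ 2))) := by
    have := integrable_exp_neg_mul_sq (b := 1 / (2 * s ^ 2)) (by positivity)
    refine this.congr (Eventually.of_forall fun x => ?_)
    simp only
    congr 1
    ring
  have hfin : volume (S ∩ Set.Icc (ρ - s) (ρ + s)) ≠ ⊤ :=
    ((measure_mono Set.inter_subset_right).trans_lt measure_Icc_lt_top).ne
  have h1 : K * (volume (S ∩ Set.Icc (ρ - s) (ρ + s))).toReal ≤
      ∫ x in S ∩ Set.Icc (ρ - s) (ρ + s), Real.exp (-x ^ 2 / (2 * s ^ 2)) := by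
    have := setIntegral_mono_on (μ := volume) (s := S ∩ Set.Icc (ρ - s) (ρ + s))
      (f := fun _ => K) (g := fun x : ℝ => Real.exp (-x ^ 2 / (2 * s ^ 2)))
      (integrableOn_const hfin) hint.integrableOn (hS.inter measurableSet_Icc) (by
        rintro x ⟨-, hx1, hx2⟩
        apply Real.exp_le_exp.mpr
        rw [div_le_div_iff₀ (by norm_num) (by positivity)]
        have hx : |x| ≤ (1 + |ρ|) * s := by
          have h0 := abs_nonneg ρ
          have h2 := le_abs_self ρ
          have h3 := neg_abs_le ρ
          rw [abs_le]
          constructor <;> nlinarith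
        have : x ^ 2 ≤ ((1 + |ρ|) * s) ^ 2 := sq_le_sq' (abs_le.mp hx).1 (abs_le.mp hx).2
        nlinarith)
    rw [setIntegral_const, smul_eq_mul, mul_comm] at this
    exact this
  have h2 : ∫ x in S ∩ Set.Icc (ρ - s) (ρ + s), Real.exp (-x ^ 2 / (2 * s ^ 2)) ≤
      ∫ x in S, Real.exp (-x ^ 2 / (2 * s ^ 2)) :=
    setIntegral_mono_set hint.integrableOn
      (Eventually.of_forall fun x => (Real.exp_pos _).le)
      (Set.inter_subset_left.eventuallyLE)
  have h3 : K * (c₁ * s) ≤ ∫ x in S, Real.exp (-x ^ 2 / (2 * s ^ 2)) :=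
    (mul_le_mul_of_nonneg_left (hlow s hs0) hK0.le).trans (h1.trans h2)
  have h4 : (2 * Real.pi * s ^ 2) ^ (-(1 : ℝ) / 2) = (Real.sqrt (2 * Real.pi) * s)⁻¹ := by
    have hp := Real.pi_pos
    rw [neg_div, Real.rpow_neg (by positivity), ← Real.sqrt_eq_rpow,
      Real.sqrt_mul (by positivity), Real.sqrt_sq hs0.le]
  rw [h4]
  have hq : 0 < Real.sqrt (2 * Real.pi) := Real.sqrt_pos.mpr (by positivity)
  calc c₁ / Real.sqrt (2 * Real.pi) * K
      = (Real.sqrt (2 * Real.pi) * s)⁻¹ * (K * (c₁ * s)) := by field_simp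
    _ ≤ _ := mul_le_mul_of_nonneg_left h3 (by positivity)
end

section
/- In the closed-loop least-squares setup, let b > 1, l₁ ≥ 0, l₂ > 0, q ∈ (0, b−1) and ε ∈ (0,1), and set S_b(l₁,l₂) := {x ∈ ℝ : |f(x)| < l₁ + l₂·|x|^b}. Define the events B_{m+1} := {y_{m+1} ∈ S_b(l₁,l₂), σ_{m+1}² ≥ r_m^q, σ_m² ≤ r_{m−1}^{(1+q)/(b−1−q) − ε}} for m ≥ 1. If liminf_{t→+∞} r_t/t > 0 almost surely, then Σ_{m=1}^∞ 1_{B_{m+1}} < +∞ almost surely; that is, almost surely only finitely many of the events B_{m+1} occur. -/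
open MeasureTheory ProbabilityTheory Filter

/-- Gaussian density formula of the statement equals `gaussianReal` after scaling. -/
lemma aux_gauss_s8 (s : ℝ) (hs : 0 < s) (A : Set ℝ) (hA : MeasurableSet A) :
    ENNReal.ofReal ((2 * Real.pi * s) ^ (-(1 : ℝ) / 2) * ∫ x in A, Real.exp (-x ^ 2 / (2 * s)))
      = gaussianReal 0 1 {z | Real.sqrt s * z ∈ A} := by
  have h1 : gaussianReal 0 1 {z | Real.sqrt s * z ∈ A}
      = ((gaussianReal 0 1).map (Real.sqrt s * ·)) A := by
    rw [Measure.map_apply (by fun_prop) hA]; rfl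
  have hv : (NNReal.mk (Real.sqrt s ^ 2) (sq_nonneg _) * 1 : NNReal) ≠ 0 := by
    rw [← NNReal.coe_ne_zero]
    simp only [mul_one, NNReal.coe_mk]
    positivity
  rw [h1, gaussianReal_map_const_mul, gaussianReal_apply_eq_integral _ hv, ← integral_const_mul]
  congr 2
  ext x
  simp only [gaussianPDFReal, mul_one, NNReal.coe_mk, mul_zero, sub_zero, Real.sq_sqrt hs.le]
  congr 1
  rw [neg_div, Real.rpow_neg (by positivity), ← Real.sqrt_eq_rpow]

/-- Law of the normalised innovation. -/
lemma aux_law {Ω : Type*} (F : MeasurableSpace Ω) [m0 : MeasurableSpace Ω] (P : Measure Ω) [IsProbabilityMeasure P]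
    (Y s : Ω → ℝ) (hY : Measurable Y) (hF : F ≤ m0)
    (hs : Measurable[F] s) (hpos : ∀ ω, 0 < s ω)
    (hG : ∀ A : Set ℝ, MeasurableSet A →
      (P[Set.indicator {ω | Y ω ∈ A} (fun _ => (1 : ℝ))|F]) =ᵐ[P]
        fun ω => (2 * Real.pi * s ω) ^ (-(1 : ℝ) / 2) *
          ∫ x in A, Real.exp (-x ^ 2 / (2 * s ω))) (a : ℝ) :
    P {ω | a * s ω ≤ Y ω ^ 2} = gaussianReal 0 1 {z | a ≤ z ^ 2} := by
  have hs0 : Measurable s := hs.mono hF le_rfl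
  have hmeas : Measurable (fun p : Ω × ℝ => (s p.1, Real.sqrt (s p.1) * p.2)) := by fun_prop
  have key : P.map (fun ω => (s ω, Y ω))
      = (P.prod (gaussianReal 0 1)).map (fun p : Ω × ℝ => (s p.1, Real.sqrt (s p.1) * p.2)) := by
    have : IsProbabilityMeasure (P.map (fun ω => (s ω, Y ω))) :=
      Measure.isProbabilityMeasure_map (by fun_prop)
    apply Measure.ext_prod
    intro S A hS hA
    rw [Measure.map_apply (by fun_prop) (hS.prod hA), Measure.map_apply hmeas (hS.prod hA),
      Measure.prod_apply (hmeas (hS.prod hA))]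
    have hSF : MeasurableSet[F] (s ⁻¹' S) := hs hS
    have hYA : MeasurableSet {ω | Y ω ∈ A} := hY hA
    have hint : Integrable (Set.indicator {ω | Y ω ∈ A} (fun _ => (1 : ℝ))) P :=
      (integrable_const 1).indicator hYA
    have e1 := setIntegral_condExp hF hint hSF
    rw [setIntegral_congr_ae (hF _ hSF) ((hG A hA).mono fun ω h _ => h)] at e1
    have hnn : ∀ ω, 0 ≤ (2 * Real.pi * s ω) ^ (-(1 : ℝ) / 2) *
          ∫ x in A, Real.exp (-x ^ 2 / (2 * s ω)) := fun ω =>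
      mul_nonneg (Real.rpow_nonneg (by have := hpos ω; positivity) _)
        (integral_nonneg fun x => (Real.exp_pos _).le)
    have hint2 : Integrable (fun ω => (2 * Real.pi * s ω) ^ (-(1 : ℝ) / 2) *
          ∫ x in A, Real.exp (-x ^ 2 / (2 * s ω))) P :=
      integrable_condExp.congr (hG A hA)
    have e2 := congrArg ENNReal.ofReal e1
    rw [ofReal_integral_eq_lintegral_ofReal hint2.integrableOn (ae_of_all _ hnn)] at e2
    rw [setIntegral_indicator hYA, setIntegral_const, smul_eq_mul, mul_one,
      ofReal_measureReal] at e2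
    have e4 : ((fun ω => (s ω, Y ω)) ⁻¹' S ×ˢ A) = s ⁻¹' S ∩ {ω | Y ω ∈ A} := by
      ext ω; simp
    rw [e4, ← e2, ← lintegral_indicator (hF _ hSF)]
    apply lintegral_congr
    intro ω
    by_cases h : s ω ∈ S
    · rw [Set.indicator_of_mem (show ω ∈ s ⁻¹' S from h), aux_gauss_s8 _ (hpos ω) A hA]
      congr 1
      ext z; simp [h]
    · rw [Set.indicator_of_notMem (show ω ∉ s ⁻¹' S from h)]
      symm
      convert measure_empty (μ := gaussianReal 0 1)
      ext z; simp [h]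
  have hT : MeasurableSet {p : ℝ × ℝ | a * p.1 ≤ p.2 ^ 2} :=
    measurableSet_le (by fun_prop) (by fun_prop)
  have e := congrArg (fun μ => μ {p : ℝ × ℝ | a * p.1 ≤ p.2 ^ 2}) key
  rw [Measure.map_apply (by fun_prop) hT, Measure.map_apply hmeas hT] at e
  have e5 : ((fun p : Ω × ℝ => (s p.1, Real.sqrt (s p.1) * p.2)) ⁻¹' {p : ℝ × ℝ | a * p.1 ≤ p.2 ^ 2})
      = Set.univ ×ˢ {z | a ≤ z ^ 2} := by
    ext ⟨ω, z⟩
    have := hpos ω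
    simp only [Set.mem_preimage, Set.mem_ofPred_eq, Set.mem_prod, Set.mem_univ, true_and]
    rw [mul_pow, Real.sq_sqrt this.le, mul_comm, mul_le_mul_iff_right₀ this]
  rw [e5, Measure.prod_prod, measure_univ, one_mul] at e
  exact e

/-- Summability of the Gaussian tails. -/
lemma aux_sum (c k δ : ℝ) (hc : 0 < c) (hk : 0 < k) (hδ : 0 < δ) :
    ∑' m : ℕ, gaussianReal 0 1 {z | c * ((m : ℝ) / k) ^ δ ≤ z ^ 2} ≠ ⊤ := by
  set p : NNReal := (4 / δ).toNNReal with hp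
  have hpp : (p : ℝ) = 4 / δ := Real.coe_toNNReal _ (by positivity)
  have hint : Integrable (fun z : ℝ => |z| ^ (4 / δ)) (gaussianReal 0 1) := by
    have := (memLp_id_gaussianReal (μ := 0) (v := 1) p).integrable_norm_rpow'
    simpa [hpp] using this
  set C := ∫ z, |z| ^ (4 / δ) ∂(gaussianReal 0 1) with hC
  set K : ℝ := c ^ (2 / δ) / k ^ 2 with hK
  have hKpos : 0 < K := by positivity
  have hb : ∀ m : ℕ, gaussianReal 0 1 {z | c * ((m : ℝ) / k) ^ δ ≤ z ^ 2}
      ≤ ENNReal.ofReal (if m = 0 then 1 else C / K * (1 / (m : ℝ) ^ 2)) := by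
    intro m
    by_cases hm : m = 0
    · rw [if_pos hm, ENNReal.ofReal_one]; exact prob_le_one
    rw [if_neg hm]
    have hm' : (0 : ℝ) < m := by exact_mod_cast Nat.pos_of_ne_zero hm
    have h1 := mul_meas_ge_le_integral_of_nonneg
      (ae_of_all (gaussianReal 0 1) fun z : ℝ => (Real.rpow_nonneg (abs_nonneg z) (4 / δ))) hint
      (K * (m : ℝ) ^ 2)
    have hsub : {z : ℝ | c * ((m : ℝ) / k) ^ δ ≤ z ^ 2} ⊆ {z | K * (m : ℝ) ^ 2 ≤ |z| ^ (4 / δ)} := by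
      intro z hz
      simp only [Set.mem_ofPred_eq] at hz ⊢
      have := Real.rpow_le_rpow (by positivity) hz (show 0 ≤ 2 / δ by positivity)
      rw [Real.mul_rpow hc.le (by positivity), ← Real.rpow_mul (by positivity)] at this
      have e : δ * (2 / δ) = (2 : ℕ) := by push_cast; field_simp
      rw [e, Real.rpow_natCast] at this
      have e2 : (z ^ 2) ^ (2 / δ) = |z| ^ (4 / δ) := by
        rw [← sq_abs, ← Real.rpow_natCast, ← Real.rpow_mul (abs_nonneg z)]
        congr 1; push_cast; ring
      rw [e2] at this
      refine le_trans (le_of_eq ?_) this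
      rw [hK]; ring
    refine (measure_mono hsub).trans ?_
    rw [← ofReal_measureReal]
    apply ENNReal.ofReal_le_ofReal
    rw [div_mul_div_comm, mul_one, le_div_iff₀ (by positivity), mul_comm]
    exact h1
  refine ne_top_of_le_ne_top ?_ (ENNReal.tsum_le_tsum hb)
  apply Summable.tsum_ofReal_ne_top
  have hs : Summable (fun m : ℕ => C / K * (1 / (m : ℝ) ^ 2)) :=
    (Real.summable_one_div_nat_pow.mpr (by norm_num)).mul_left _
  rw [← summable_nat_add_iff 1] at hs ⊢
  simpa using hs

/-- Deterministic lower bound on the event. -/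
lemma aux_det (b l₁ l₂ q ε : ℝ) (hb : 1 < b) (hl₂ : 0 < l₂)
    (hq : q ∈ Set.Ioo 0 (b - 1)) (hε : 0 < ε) :
    ∃ c > 0, ∃ δ : ℝ, 0 < δ ∧ ∃ M : ℝ, 0 < M ∧ ∀ r r' φ x : ℝ, M ≤ r → r ≤ r' →
      |φ| < l₁ + l₂ * |x| ^ b → r' ^ q ≤ (r' + φ ^ 2) / r' →
      r' / r ≤ r ^ ((1 + q) / (b - 1 - q) - ε) → c * r ^ δ * (r' / r) ≤ x ^ 2 := by
  obtain ⟨hq0, hq1⟩ := hq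
  have hα : 0 < 1 - (1 + q) / b := by
    rw [sub_pos, div_lt_one (by linarith)]; linarith
  have ev : ∀ᶠ r : ℝ in atTop, 1 ≤ r ∧ 2 ≤ r ^ q ∧ 4 * l₁ ≤ r ^ ((1 + q) / 2) :=
    (eventually_ge_atTop 1).and (((tendsto_rpow_atTop hq0).eventually_ge_atTop 2).and
      ((tendsto_rpow_atTop (by linarith)).eventually_ge_atTop _))
  obtain ⟨M, hM⟩ := eventually_atTop.1 ev
  refine ⟨(1 / (4 * l₂)) ^ (2 / b), by positivity, ε * (1 - (1 + q) / b), by positivity,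
    max M 1, by positivity, ?_⟩
  intro r r' φ x hr hrr hφ hq' hσ
  have hr1 : 1 ≤ r := (le_max_right _ _).trans hr
  obtain ⟨h1, h2, h3⟩ := hM r' (((le_max_left _ _).trans hr).trans hrr)
  have hr0 : 0 < r := by linarith
  have hr'0 : 0 < r' := by linarith
  rw [le_div_iff₀ hr'0] at hq'
  set u := r' ^ ((1 + q) / 2) with hu
  have hu0 : 0 < u := by positivity
  have hu2 : u ^ 2 = r' ^ q * r' := by
    rw [hu, ← Real.rpow_natCast, ← Real.rpow_mul hr'0.le]
    nth_rewrite 3 [← Real.rpow_one r']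
    rw [← Real.rpow_add hr'0]
    congr 1; push_cast; ring
  have hφ2 : u / 2 ≤ |φ| := by
    refine (abs_le_of_sq_le_sq' ?_ (abs_nonneg _)).2
    rw [sq_abs]
    nlinarith
  have hx : 1 / (4 * l₂) * u ≤ |x| ^ b := by
    rw [div_mul_eq_mul_div, div_le_iff₀ (by positivity)]
    linarith
  have hx2 := Real.rpow_le_rpow (by positivity) hx (show 0 ≤ 2 / b by positivity)
  rw [Real.mul_rpow (by positivity) hu0.le, ← Real.rpow_mul (abs_nonneg x), hu,
    ← Real.rpow_mul hr'0.le] at hx2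
  have e1 : b * (2 / b) = (2 : ℕ) := by push_cast; field_simp
  rw [e1, Real.rpow_natCast, sq_abs] at hx2
  refine le_trans ?_ hx2
  rw [mul_assoc]
  refine mul_le_mul_of_nonneg_left ?_ (by positivity)
  have e2 : (1 + q) / 2 * (2 / b) = (1 + q) / b := by ring
  rw [e2]
  set s := r' / r with hs
  have hs0 : 0 < s := by positivity
  have hr's : r' = s * r := by rw [hs]; field_simp
  rw [hr's, Real.mul_rpow hs0.le hr0.le]
  have h5 := Real.rpow_le_rpow hs0.le hσ hα.le
  rw [← Real.rpow_mul hr0.le] at h5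
  have e3 : ((1 + q) / (b - 1 - q) - ε) * (1 - (1 + q) / b)
      = (1 + q) / b - ε * (1 - (1 + q) / b) := by
    have : b - 1 - q ≠ 0 := by linarith
    have : b ≠ 0 := by linarith
    field_simp
    ring
  rw [e3] at h5
  have e4 : r ^ ((1 + q) / b) = r ^ (ε * (1 - (1 + q) / b)) * r ^ ((1 + q) / b - ε * (1 - (1 + q) / b)) := by
    rw [← Real.rpow_add hr0]; congr 1; ring
  have e5 : s = s ^ ((1 + q) / b) * s ^ (1 - (1 + q) / b) := by
    rw [← Real.rpow_add hs0, add_sub_cancel, Real.rpow_one]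
  rw [e4]
  nth_rewrite 1 [e5]
  have : 0 ≤ r ^ (ε * (1 - (1 + q) / b)) * s ^ ((1 + q) / b) := by positivity
  nlinarith [mul_le_mul_of_nonneg_left h5 this]

/-- Lemma 3 (events `B`): in the closed-loop least-squares setup, with `b > 1`,
`l₁ ≥ 0`, `l₂ > 0`, `q ∈ (0, b-1)`, `ε ∈ (0,1)`, if `liminf r t / t > 0` a.s. then
almost surely only finitely many of the events
`B (m+1) = {y (m+1) ∈ S_b(l₁,l₂), σ (m+1)² ≥ r m ^ q, σ m² ≤ r (m-1) ^ ((1+q)/(b-1-q) - ε)}`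
occur. -/
theorem stmt_8
    {Ω : Type*} [MeasurableSpace Ω] (P : Measure Ω) [IsProbabilityMeasure P]
    (y : ℕ → Ω → ℝ) (hy : ∀ t, Measurable (y t))
    (f : ℝ → ℝ) (hf : Measurable f)
    (P₀ : ℝ) (hP₀ : 0 < P₀)
    (R σ2 : ℕ → Ω → ℝ)
    (hR : ∀ t ω, R t ω = P₀⁻¹ + ∑ i ∈ Finset.range t, (f (y i ω)) ^ 2)
    (hσ2 : ∀ t ω, σ2 t ω = R (t + 1) ω / R t ω)
    (𝔉 : ℕ → MeasurableSpace Ω)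
    (h𝔉 : ∀ t, 𝔉 t = ⨆ i : Fin (t + 1), MeasurableSpace.comap (y i) inferInstance)
    (hGauss : ∀ t : ℕ, ∀ A : Set ℝ, MeasurableSet A →
      (P[Set.indicator {ω | y (t + 1) ω ∈ A} (fun _ => (1 : ℝ))|𝔉 t]) =ᵐ[P]
        fun ω => (2 * Real.pi * σ2 t ω) ^ (-(1 : ℝ) / 2) *
          ∫ x in A, Real.exp (-x ^ 2 / (2 * σ2 t ω)))
    (b l₁ l₂ q ε : ℝ) (hb : 1 < b) (hl₁ : 0 ≤ l₁) (hl₂ : 0 < l₂)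
    (hq : q ∈ Set.Ioo 0 (b - 1)) (hε : ε ∈ Set.Ioo (0 : ℝ) 1)
    (hliminf : ∀ᵐ ω ∂P, (0 : EReal) < Filter.liminf
      (fun t : ℕ => ((R (t + 1) ω / t : ℝ) : EReal)) Filter.atTop) :
    ∀ᵐ ω ∂P,
      {m : ℕ | 1 ≤ m ∧ |f (y (m + 1) ω)| < l₁ + l₂ * |y (m + 1) ω| ^ b ∧
        (R (m + 1) ω) ^ q ≤ σ2 (m + 1) ω ∧
        σ2 m ω ≤ (R m ω) ^ ((1 + q) / (b - 1 - q) - ε)}.Finite := by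
  have hP0' : 0 < P₀⁻¹ := inv_pos.mpr hP₀
  have hRpos : ∀ t ω, 0 < R t ω := fun t ω => by
    rw [hR]
    have : 0 ≤ ∑ i ∈ Finset.range t, (f (y i ω)) ^ 2 := Finset.sum_nonneg fun i _ => sq_nonneg _
    linarith
  have hRs : ∀ t ω, R (t + 1) ω = R t ω + (f (y t ω)) ^ 2 := fun t ω => by
    rw [hR, hR, Finset.sum_range_succ, add_assoc]
  have hyF : ∀ t i, i ≤ t → Measurable[𝔉 t] (y i) := fun t i hi => by
    rw [h𝔉]
    have h1 : MeasurableSpace.comap (y i) inferInstance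
        ≤ ⨆ i : Fin (t + 1), MeasurableSpace.comap (y i) inferInstance :=
      le_iSup (fun i : Fin (t + 1) => MeasurableSpace.comap (y i) inferInstance)
        ⟨i, Nat.lt_succ_of_le hi⟩
    exact (comap_measurable (y i)).mono h1 le_rfl
  have hF : ∀ t, 𝔉 t ≤ ‹MeasurableSpace Ω› := fun t => by
    rw [h𝔉]
    exact iSup_le fun i => (hy i).comap_le
  have hRF : ∀ t j, j ≤ t + 1 → Measurable[𝔉 t] (R j) := fun t j hj => by
    have : R j = fun ω => P₀⁻¹ + ∑ i ∈ Finset.range j, (f (y i ω)) ^ 2 := funext (hR j)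
    rw [this]
    refine measurable_const.add (Finset.measurable_fun_sum _ fun i hi => ?_)
    exact (hf.comp (hyF t i (by have := Finset.mem_range.1 hi; omega))).pow_const 2
  have hσF : ∀ t, Measurable[𝔉 t] (σ2 t) := fun t => by
    have : σ2 t = fun ω => R (t + 1) ω / R t ω := funext (hσ2 t)
    rw [this]
    exact (hRF t _ le_rfl).div (hRF t _ (Nat.le_succ t))
  have hσpos : ∀ t ω, 0 < σ2 t ω := fun t ω => by
    rw [hσ2]; exact div_pos (hRpos _ _) (hRpos _ _)
  obtain ⟨c, hc, δ, hδ, M, hM, hdet⟩ := aux_det b l₁ l₂ q ε hb hl₂ hq hε.1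
  have hBC : ∀ k : ℕ, ∀ᵐ ω ∂P, ∀ᶠ m : ℕ in atTop,
      ¬ (c * ((m : ℝ) / ((k : ℝ) + 1)) ^ δ * σ2 m ω ≤ y (m + 1) ω ^ 2) := by
    intro k
    refine ae_eventually_notMem
      (s := fun m : ℕ => {ω | c * ((m : ℝ) / ((k : ℝ) + 1)) ^ δ * σ2 m ω ≤ y (m + 1) ω ^ 2}) ?_
    have : ∀ m : ℕ, P {ω | c * ((m : ℝ) / ((k : ℝ) + 1)) ^ δ * σ2 m ω ≤ y (m + 1) ω ^ 2}
        = gaussianReal 0 1 {z | c * ((m : ℝ) / ((k : ℝ) + 1)) ^ δ ≤ z ^ 2} := fun m =>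
      aux_law (𝔉 m) P (y (m + 1)) (σ2 m) (hy _) (hF m) (hσF m) (hσpos m) (hGauss m) _
    simp_rw [this]
    exact aux_sum c _ δ hc (by positivity) hδ
  filter_upwards [ae_all_iff.2 hBC, hliminf] with ω hω hlim
  obtain ⟨d, hd0, hd⟩ := EReal.lt_iff_exists_real_btwn.1 hlim
  have hd0' : 0 < d := by exact_mod_cast hd0
  have hev := eventually_lt_of_lt_liminf hd
  obtain ⟨k, hk⟩ := exists_nat_gt (2 / d)
  have hkd : 2 < d * ((k : ℝ) + 1) := by
    rw [div_lt_iff₀ hd0'] at hk; nlinarith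
  have hgrow : ∀ᶠ m : ℕ in atTop, (m : ℝ) / ((k : ℝ) + 1) ≤ R m ω := by
    have h2 : ∀ᶠ t : ℕ in atTop, ((t + 1 : ℕ) : ℝ) / ((k : ℝ) + 1) ≤ R (t + 1) ω := by
      filter_upwards [hev, eventually_ge_atTop 1] with t ht ht1
      have ht1' : (1 : ℝ) ≤ t := by exact_mod_cast ht1
      have ht' : d < R (t + 1) ω / t := by exact_mod_cast ht
      rw [lt_div_iff₀ (by linarith)] at ht'
      rw [div_le_iff₀ (by positivity)]
      push_cast
      have hk0 : (0 : ℝ) < (k : ℝ) + 1 := by positivity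
      nlinarith [mul_lt_mul_of_pos_right ht' hk0]
    rw [← map_add_atTop_eq_nat 1]
    exact eventually_map.2 h2
  have hlarge : ∀ᶠ m : ℕ in atTop, M ≤ (m : ℝ) / ((k : ℝ) + 1) :=
    (tendsto_natCast_atTop_atTop.atTop_div_const (by positivity)).eventually_ge_atTop M
  obtain ⟨N, hN⟩ := eventually_atTop.1 ((hω k).and (hgrow.and hlarge))
  refine (Set.finite_lt_nat N).subset ?_
  rintro m ⟨-, h1, h2, h3⟩
  by_contra hm
  obtain ⟨n1, n2, n3⟩ := hN m (not_lt.1 hm)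
  apply n1
  rw [hσ2, hRs (m + 1)] at h2
  rw [hσ2] at h3 ⊢
  have hmono : R m ω ≤ R (m + 1) ω := by rw [hRs]; nlinarith [sq_nonneg (f (y m ω))]
  have := hdet (R m ω) (R (m + 1) ω) (f (y (m + 1) ω)) (y (m + 1) ω) (n3.trans n2) hmono h1 h2 h3
  refine le_trans ?_ this
  have hrp : ((m : ℝ) / ((k : ℝ) + 1)) ^ δ ≤ (R m ω) ^ δ :=
    Real.rpow_le_rpow (by positivity) n2 hδ.le
  have : 0 < R (m + 1) ω / R m ω := div_pos (hRpos _ _) (hRpos _ _)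
  gcongr
end

section
/- In the closed-loop least-squares setup, let b > 1, l₁ ≥ 0, l₂ > 0, ε ∈ (0,1) and λ > 1, and set S_b(l₁,l₂) := {x ∈ ℝ : |f(x)| < l₁ + l₂·|x|^b}. Define the events C_{m+1} := {y_{m+1} ∈ S_b(l₁,l₂), σ_{m+1}² ≥ λ, σ_m² ≤ r_{m−1}^{1/(b−1) − ε}} for m ≥ 1. If liminf_{t→+∞} r_t/t > 0 almost surely, then Σ_{m=1}^∞ 1_{C_{m+1}} < +∞ almost surely; that is, almost surely only finitely many of the events C_{m+1} occur. -/
open MeasureTheory ProbabilityTheory Filter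

/-- Gaussian tail bound. -/
lemma gauss_tail (s a : ℝ) (hs : 0 < s) :
    (2 * Real.pi * s) ^ (-(1 : ℝ) / 2) *
      ∫ x in {x : ℝ | a < x ^ 2}, Real.exp (-x ^ 2 / (2 * s)) ≤
      Real.sqrt 2 * Real.exp (-(a / (4 * s))) := by
  have hmeas : MeasurableSet {x : ℝ | a < x ^ 2} :=
    measurableSet_lt measurable_const (by fun_prop)
  have hI1 : Integrable (fun x : ℝ => Real.exp (-x ^ 2 / (2 * s))) := by
    have := integrable_exp_neg_mul_sq (b := 1 / (2 * s)) (by positivity)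
    refine this.congr (Eventually.of_forall fun x => ?_)
    simp only
    congr 1
    field_simp
  have hI2 : Integrable (fun x : ℝ => Real.exp (-(1 / (4 * s)) * x ^ 2)) :=
    integrable_exp_neg_mul_sq (b := 1 / (4 * s)) (by positivity)
  have h1 : ∫ x in {x : ℝ | a < x ^ 2}, Real.exp (-x ^ 2 / (2 * s)) ≤
      ∫ x in {x : ℝ | a < x ^ 2},
        Real.exp (-(a / (4 * s))) * Real.exp (-(1 / (4 * s)) * x ^ 2) := by
    refine setIntegral_mono_on hI1.integrableOn (hI2.const_mul _).integrableOn hmeas ?_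
    intro x hx
    rw [← Real.exp_add, Real.exp_le_exp]
    have hx' : a < x ^ 2 := hx
    have e : -(a / (4 * s)) + -(1 / (4 * s)) * x ^ 2 - -x ^ 2 / (2 * s)
        = (x ^ 2 - a) / (4 * s) := by
      field_simp
      ring
    have : 0 ≤ (x ^ 2 - a) / (4 * s) := div_nonneg (by linarith) (by positivity)
    linarith
  have h2 : ∫ x in {x : ℝ | a < x ^ 2},
        Real.exp (-(a / (4 * s))) * Real.exp (-(1 / (4 * s)) * x ^ 2) ≤
      Real.exp (-(a / (4 * s))) * Real.sqrt (Real.pi / (1 / (4 * s))) := by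
    rw [← integral_gaussian, ← integral_const_mul]
    exact setIntegral_le_integral (hI2.const_mul _)
      (Eventually.of_forall fun x => by positivity)
  have h3 : (2 * Real.pi * s) ^ (-(1 : ℝ) / 2) * Real.sqrt (Real.pi / (1 / (4 * s)))
      = Real.sqrt 2 := by
    have hp : 0 < 2 * Real.pi * s := by positivity
    rw [show (-(1 : ℝ) / 2) = -(1 / 2) by ring, Real.rpow_neg hp.le, ← Real.sqrt_eq_rpow,
      ← Real.sqrt_inv, ← Real.sqrt_mul (by positivity)]
    congr 1
    field_simp
    ring
  calc _ ≤ (2 * Real.pi * s) ^ (-(1 : ℝ) / 2) *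
        (Real.exp (-(a / (4 * s))) * Real.sqrt (Real.pi / (1 / (4 * s)))) :=
        mul_le_mul_of_nonneg_left (h1.trans h2) (by positivity)
    _ = _ := by rw [mul_left_comm, h3, mul_comm]

/-- One bin. -/
lemma bin_bound {Ω : Type*} (F : MeasurableSpace Ω) [m0 : MeasurableSpace Ω] (P : Measure Ω) [IsProbabilityMeasure P]
    (Y S : Ω → ℝ) (hY : Measurable Y) (hF : F ≤ m0)
    (hS : Measurable[F] S) (hS1 : ∀ ω, 1 ≤ S ω)
    (hG : ∀ A : Set ℝ, MeasurableSet A →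
      (P[Set.indicator {ω | Y ω ∈ A} (fun _ => (1 : ℝ))|F]) =ᵐ[P]
        fun ω => (2 * Real.pi * S ω) ^ (-(1 : ℝ) / 2) *
          ∫ x in A, Real.exp (-x ^ 2 / (2 * S ω)))
    (κ : ℝ) (hκ : 0 ≤ κ) (k : ℕ) :
    P ({ω | ⌊S ω⌋₊ = k} ∩ {ω | κ * k < Y ω ^ 2}) ≤
      ENNReal.ofReal (Real.sqrt 2 * Real.exp (-(κ / 8))) * P {ω | ⌊S ω⌋₊ = k} := by
  set A : Set ℝ := {x : ℝ | κ * k < x ^ 2} with hA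
  have hAm : MeasurableSet A := measurableSet_lt measurable_const (by fun_prop)
  set B : Set Ω := {ω | ⌊S ω⌋₊ = k} with hB
  have hBF : MeasurableSet[F] B :=
    (Nat.measurable_floor.comp hS) (measurableSet_singleton k)
  have hBm : MeasurableSet B := hF _ hBF
  have hE : MeasurableSet {ω | Y ω ∈ A} := hY hAm
  have hint : Integrable (Set.indicator {ω | Y ω ∈ A} (fun _ => (1 : ℝ))) P :=
    (integrable_const 1).indicator hE
  have key := setIntegral_condExp hF hint hBF
  have h1 : ∫ ω in B, Set.indicator {ω | Y ω ∈ A} (fun _ => (1 : ℝ)) ω ∂P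
      = P.real (B ∩ {ω | Y ω ∈ A}) := by
    rw [setIntegral_indicator hE]
    simp
  have h2 : ∫ ω in B, (P[Set.indicator {ω | Y ω ∈ A} (fun _ => (1 : ℝ))|F]) ω ∂P
      ≤ ∫ ω in B, Real.sqrt 2 * Real.exp (-(κ / 8)) ∂P := by
    refine setIntegral_mono_on_ae integrable_condExp.integrableOn
      (integrable_const _).integrableOn hBm ?_
    filter_upwards [hG A hAm] with ω hω hωB
    rw [hω]
    have hs : 0 < S ω := by linarith [hS1 ω]
    refine (gauss_tail (S ω) (κ * k) hs).trans ?_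
    have hk : S ω < k + 1 := by
      have := Nat.lt_floor_add_one (S ω)
      rwa [show ⌊S ω⌋₊ = k from hωB] at this
    have hk1 : (1 : ℝ) ≤ k := by
      have : 1 ≤ ⌊S ω⌋₊ := Nat.le_floor (by simpa using hS1 ω)
      rw [show ⌊S ω⌋₊ = k from hωB] at this
      exact_mod_cast this
    refine mul_le_mul_of_nonneg_left (Real.exp_le_exp.2 (neg_le_neg ?_)) (Real.sqrt_nonneg _)
    rw [div_le_div_iff₀ (by norm_num) (by positivity)]
    nlinarith
  rw [key, h1] at h2
  simp only [setIntegral_const, smul_eq_mul] at h2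
  have e1 : P (B ∩ {ω | Y ω ∈ A}) = ENNReal.ofReal (P.real (B ∩ {ω | Y ω ∈ A})) := by simp
  have e2 : P B = ENNReal.ofReal (P.real B) := by simp
  change P (B ∩ {ω | Y ω ∈ A}) ≤ _
  rw [e1, e2, ← ENNReal.ofReal_mul (by positivity)]
  apply ENNReal.ofReal_le_ofReal
  linarith

lemma event_bound {Ω : Type*} (F : MeasurableSpace Ω) [m0 : MeasurableSpace Ω] (P : Measure Ω) [IsProbabilityMeasure P]
    (Y S : Ω → ℝ) (hY : Measurable Y) (hF : F ≤ m0)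
    (hS : Measurable[F] S) (hS1 : ∀ ω, 1 ≤ S ω)
    (hG : ∀ A : Set ℝ, MeasurableSet A →
      (P[Set.indicator {ω | Y ω ∈ A} (fun _ => (1 : ℝ))|F]) =ᵐ[P]
        fun ω => (2 * Real.pi * S ω) ^ (-(1 : ℝ) / 2) *
          ∫ x in A, Real.exp (-x ^ 2 / (2 * S ω)))
    (κ : ℝ) (hκ : 0 ≤ κ) :
    P {ω | κ * S ω < Y ω ^ 2} ≤ ENNReal.ofReal (Real.sqrt 2 * Real.exp (-(κ / 8))) := by
  have hsub : {ω | κ * S ω < Y ω ^ 2} ⊆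
      ⋃ k : ℕ, ({ω | ⌊S ω⌋₊ = k} ∩ {ω | κ * k < Y ω ^ 2}) := by
    intro ω hω
    simp only [Set.mem_iUnion]
    refine ⟨⌊S ω⌋₊, rfl, ?_⟩
    have h1 : (⌊S ω⌋₊ : ℝ) ≤ S ω := Nat.floor_le (by linarith [hS1 ω])
    exact lt_of_le_of_lt (mul_le_mul_of_nonneg_left h1 hκ) hω
  have hdisj : ∑' k : ℕ, P {ω | ⌊S ω⌋₊ = k} ≤ 1 := by
    rw [← measure_iUnion]
    · exact prob_le_one
    · intro i j hij
      rw [Function.onFun, Set.disjoint_left]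
      intro ω h1 h2
      exact hij (h1.symm.trans h2)
    · intro k
      exact hF _ ((Nat.measurable_floor.comp hS) (measurableSet_singleton k))
  calc _ ≤ _ := measure_mono hsub
    _ ≤ _ := measure_iUnion_le _
    _ ≤ ∑' k : ℕ, ENNReal.ofReal (Real.sqrt 2 * Real.exp (-(κ / 8))) * P {ω | ⌊S ω⌋₊ = k} :=
        ENNReal.tsum_le_tsum fun k => bin_bound F P Y S hY hF hS hS1 hG κ hκ k
    _ ≤ _ := by
        rw [ENNReal.tsum_mul_left]
        exact mul_le_of_le_one_right' hdisj

lemma summable_tail (η : ℝ) (hη : 0 < η) :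
    Summable (fun m : ℕ => Real.sqrt 2 * Real.exp (-((m : ℝ) ^ η / 8))) := by
  apply Summable.mul_left
  obtain ⟨n, hn⟩ := exists_nat_gt (1 / η)
  have hn' : 1 < η * n := by
    rw [div_lt_iff₀ hη] at hn
    linarith
  have hs : Summable (fun m : ℕ => ((n.factorial : ℝ) * 8 ^ n) * (1 / (m : ℝ) ^ (η * n))) :=
    (Real.summable_one_div_nat_rpow.2 hn').mul_left _
  refine Summable.of_norm_bounded_eventually_nat hs ?_
  filter_upwards [eventually_gt_atTop 0] with m hm
  have hm' : (0 : ℝ) < m := by exact_mod_cast hm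
  rw [Real.norm_eq_abs, abs_of_pos (Real.exp_pos _), Real.exp_neg]
  have h := Real.pow_div_factorial_le_exp ((m : ℝ) ^ η / 8) (by positivity) n
  have hp : (0 : ℝ) < ((m : ℝ) ^ η / 8) ^ n / n.factorial := by positivity
  refine (inv_anti₀ hp h).trans (le_of_eq ?_)
  rw [Real.rpow_mul hm'.le, Real.rpow_natCast, div_pow]
  field_simp

/-- The deterministic estimate. -/
lemma determ (b l₁ l₂ ε lam c η : ℝ) (hb : 1 < b) (hl₁ : 0 ≤ l₁) (hl₂ : 0 < l₂)
    (hlam : 1 < lam) (hc : 0 < c) (hε : 0 < ε)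
    (hη : η = ε * (b - 1) / (2 * b)) (m r s y fy : ℝ) (hm : 1 ≤ m) (hs : 1 ≤ s)
    (hr : c * m ≤ r) (hy : y ^ 2 ≤ m ^ η * s)
    (hf : |fy| < l₁ + l₂ * |y| ^ b) (h1 : (lam - 1) * (s * r) ≤ fy ^ 2)
    (h2 : s ≤ r ^ (1 / (b - 1) - ε)) :
    (lam - 1) * c ^ (ε * (b - 1)) * m ^ (ε * (b - 1) / 2) ≤ (l₁ + l₂) ^ 2 := by
  have hm0 : 0 < m := by linarith
  have hr0 : 0 < r := lt_of_lt_of_le (by positivity) hr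
  have hs0 : 0 < s := by linarith
  have hb1 : 0 < b - 1 := by linarith
  have hη0 : 0 < η := by rw [hη]; positivity
  set q := m ^ η * s with hq
  have hmη : 1 ≤ m ^ η := Real.one_le_rpow hm hη0.le
  have hq1 : 1 ≤ q := by rw [hq]; nlinarith
  have hq0 : 0 < q := by linarith
  have hyb : |y| ^ b ≤ q ^ (b / 2) := by
    have : |y| ^ b = (y ^ 2) ^ (b / 2) := by
      rw [← sq_abs, ← Real.rpow_natCast, ← Real.rpow_mul (abs_nonneg _)]
      congr 1
      push_cast
      ring
    rw [this]
    exact Real.rpow_le_rpow (sq_nonneg _) hy (by positivity)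
  have hqb : 1 ≤ q ^ (b / 2) := Real.one_le_rpow hq1 (by positivity)
  have hf2 : |fy| ≤ (l₁ + l₂) * q ^ (b / 2) := by nlinarith
  have hfsq : fy ^ 2 ≤ (l₁ + l₂) ^ 2 * q ^ b := by
    have h := pow_le_pow_left₀ (abs_nonneg fy) hf2 2
    rw [sq_abs, mul_pow, ← Real.rpow_natCast (q ^ (b / 2)), ← Real.rpow_mul hq0.le] at h
    rwa [show b / 2 * ((2 : ℕ) : ℝ) = b by push_cast; ring] at h
  have hqb' : q ^ b = m ^ (ε * (b - 1) / 2) * (s ^ (b - 1) * s) := by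
    rw [hq, Real.mul_rpow (by positivity) hs0.le, ← Real.rpow_mul hm0.le,
      ← Real.rpow_add_one hs0.ne']
    congr 2
    · rw [hη]; field_simp
    · ring
  have hsb : s ^ (b - 1) * r ^ (ε * (b - 1)) ≤ r := by
    have h := Real.rpow_le_rpow hs0.le h2 hb1.le
    rw [← Real.rpow_mul hr0.le] at h
    calc _ ≤ _ := mul_le_mul_of_nonneg_right h (by positivity)
      _ = r := by
        rw [← Real.rpow_add hr0]
        conv_rhs => rw [← Real.rpow_one r]
        congr 1
        field_simp
        ring
  set θ := ε * (b - 1) / 2 with hθ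
  have hrε : c ^ (ε * (b - 1)) * (m ^ θ * m ^ θ) ≤ r ^ (ε * (b - 1)) := by
    rw [← Real.rpow_add hm0, show θ + θ = ε * (b - 1) by rw [hθ]; ring,
      ← Real.mul_rpow hc.le hm0.le]
    exact Real.rpow_le_rpow (by positivity) hr (by positivity)
  have hmθ : 0 < m ^ θ := by positivity
  -- combine
  have e1 : (lam - 1) * (s * r) ≤ (l₁ + l₂) ^ 2 * (m ^ θ * (s ^ (b - 1) * s)) := by
    rw [← hqb']; exact h1.trans hfsq
  have e2 : (lam - 1) * r ≤ (l₁ + l₂) ^ 2 * (m ^ θ * s ^ (b - 1)) := by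
    refine le_of_mul_le_mul_right ?_ hs0
    linarith
  have hS : 0 < s ^ (b - 1) := by positivity
  have hlam' : 0 < lam - 1 := by linarith
  have e3 : (lam - 1) * (s ^ (b - 1) * (c ^ (ε * (b - 1)) * (m ^ θ * m ^ θ))) ≤
      (lam - 1) * r := by
    refine mul_le_mul_of_nonneg_left ?_ hlam'.le
    exact (mul_le_mul_of_nonneg_left hrε hS.le).trans hsb
  refine le_of_mul_le_mul_right ?_ (mul_pos hmθ hS)
  linarith [e2, e3]

/-- Lemma 3 (events `C`): in the closed-loop least-squares setup, with `b > 1`,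
`l₁ ≥ 0`, `l₂ > 0`, `ε ∈ (0,1)`, `λ > 1`, if `liminf r t / t > 0` a.s. then almost
surely only finitely many of the events
`C (m+1) = {y (m+1) ∈ S_b(l₁,l₂), σ (m+1)² ≥ λ, σ m² ≤ r (m-1) ^ (1/(b-1) - ε)}` occur. -/
theorem stmt_9
    {Ω : Type*} [MeasurableSpace Ω] (P : Measure Ω) [IsProbabilityMeasure P]
    (y : ℕ → Ω → ℝ) (hy : ∀ t, Measurable (y t))
    (f : ℝ → ℝ) (hf : Measurable f)
    (P₀ : ℝ) (hP₀ : 0 < P₀)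
    (R σ2 : ℕ → Ω → ℝ)
    (hR : ∀ t ω, R t ω = P₀⁻¹ + ∑ i ∈ Finset.range t, (f (y i ω)) ^ 2)
    (hσ2 : ∀ t ω, σ2 t ω = R (t + 1) ω / R t ω)
    (𝔉 : ℕ → MeasurableSpace Ω)
    (h𝔉 : ∀ t, 𝔉 t = ⨆ i : Fin (t + 1), MeasurableSpace.comap (y i) inferInstance)
    (hGauss : ∀ t : ℕ, ∀ A : Set ℝ, MeasurableSet A →
      (P[Set.indicator {ω | y (t + 1) ω ∈ A} (fun _ => (1 : ℝ))|𝔉 t]) =ᵐ[P]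
        fun ω => (2 * Real.pi * σ2 t ω) ^ (-(1 : ℝ) / 2) *
          ∫ x in A, Real.exp (-x ^ 2 / (2 * σ2 t ω)))
    (b l₁ l₂ ε lam : ℝ) (hb : 1 < b) (hl₁ : 0 ≤ l₁) (hl₂ : 0 < l₂)
    (hε : ε ∈ Set.Ioo (0 : ℝ) 1) (hlam : 1 < lam)
    (hliminf : ∀ᵐ ω ∂P, (0 : EReal) < Filter.liminf
      (fun t : ℕ => ((R (t + 1) ω / t : ℝ) : EReal)) Filter.atTop) :
    ∀ᵐ ω ∂P,
      {m : ℕ | 1 ≤ m ∧ |f (y (m + 1) ω)| < l₁ + l₂ * |y (m + 1) ω| ^ b ∧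
        lam ≤ σ2 (m + 1) ω ∧
        σ2 m ω ≤ (R m ω) ^ (1 / (b - 1) - ε)}.Finite := by
  have hRpos : ∀ t ω, 0 < R t ω := by
    intro t ω
    rw [hR]
    have : 0 ≤ ∑ i ∈ Finset.range t, (f (y i ω)) ^ 2 := Finset.sum_nonneg fun i _ => sq_nonneg _
    positivity
  have hRsucc : ∀ t ω, R (t + 1) ω = R t ω + f (y t ω) ^ 2 := by
    intro t ω
    rw [hR, hR, Finset.sum_range_succ]
    ring
  have hσ1 : ∀ t ω, 1 ≤ σ2 t ω := by
    intro t ω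
    rw [hσ2, le_div_iff₀ (hRpos t ω), hRsucc]
    nlinarith [sq_nonneg (f (y t ω))]
  have hF : ∀ t, 𝔉 t ≤ ‹MeasurableSpace Ω› := by
    intro t
    rw [h𝔉]
    exact iSup_le fun i => (hy i).comap_le
  have hyF : ∀ t i, i ≤ t → Measurable[𝔉 t] (y i) := by
    intro t i hi
    rw [measurable_iff_comap_le, h𝔉]
    exact le_iSup (fun i : Fin (t + 1) => MeasurableSpace.comap (y i) inferInstance)
      ⟨i, by omega⟩
  have hRF : ∀ t n, n ≤ t + 1 → Measurable[𝔉 t] (R n) := by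
    intro t n hn
    have : R n = fun ω => P₀⁻¹ + ∑ i ∈ Finset.range n, (f (y i ω)) ^ 2 := funext (hR n)
    rw [this]
    refine Measurable.const_add ?_ _
    refine Finset.measurable_fun_sum _ fun i hi => ?_
    have := Finset.mem_range.1 hi
    exact (hf.comp (hyF t i (by omega))).pow_const 2
  have hσF : ∀ t, Measurable[𝔉 t] (σ2 t) := by
    intro t
    have : σ2 t = fun ω => R (t + 1) ω / R t ω := funext (hσ2 t)
    rw [this]
    exact (hRF t _ le_rfl).div (hRF t t (by omega))
  have hb1 : 0 < b - 1 := by linarith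
  have hε0 : 0 < ε := hε.1
  obtain ⟨η, hη⟩ : ∃ η, η = ε * (b - 1) / (2 * b) := ⟨_, rfl⟩
  have hη0 : 0 < η := by rw [hη]; positivity
  have hBC : ∀ᵐ ω ∂P, ∀ᶠ m : ℕ in atTop,
      ¬ ((m : ℝ) ^ η * σ2 m ω < y (m + 1) ω ^ 2) := by
    refine ae_eventually_notMem
      (s := fun m : ℕ => {ω | (m : ℝ) ^ η * σ2 m ω < y (m + 1) ω ^ 2}) ?_
    refine ne_top_of_le_ne_top (summable_tail η hη0).tsum_ofReal_ne_top
      (ENNReal.tsum_le_tsum fun m => ?_)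
    exact event_bound (𝔉 m) P (y (m + 1)) (σ2 m) (hy _) (hF m) (hσF m) (hσ1 m) (hGauss m)
      ((m : ℝ) ^ η) (by positivity)
  filter_upwards [hBC, hliminf] with ω h1 h2
  obtain ⟨c, hc0, hcl⟩ := EReal.lt_iff_exists_real_btwn.1 h2
  have hc : 0 < c := by exact_mod_cast hc0
  have hev : ∀ᶠ t : ℕ in atTop, c < R (t + 1) ω / t := by
    filter_upwards [eventually_lt_of_lt_liminf hcl] with t ht
    exact_mod_cast ht
  obtain ⟨N, hN⟩ := eventually_atTop.1 hev
  have hθ : 0 < ε * (b - 1) / 2 := by positivity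
  have hK : 0 < (lam - 1) * (c / 2) ^ (ε * (b - 1)) := by
    have : 0 < lam - 1 := by linarith
    positivity
  have htend : Tendsto (fun m : ℕ => (lam - 1) * (c / 2) ^ (ε * (b - 1)) *
      (m : ℝ) ^ (ε * (b - 1) / 2)) atTop atTop :=
    Tendsto.const_mul_atTop hK ((tendsto_rpow_atTop hθ).comp tendsto_natCast_atTop_atTop)
  have hfin : ∀ᶠ m : ℕ in atTop, m ∉ {m : ℕ | 1 ≤ m ∧
      |f (y (m + 1) ω)| < l₁ + l₂ * |y (m + 1) ω| ^ b ∧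
        lam ≤ σ2 (m + 1) ω ∧ σ2 m ω ≤ (R m ω) ^ (1 / (b - 1) - ε)} := by
    filter_upwards [h1, htend.eventually_gt_atTop ((l₁ + l₂) ^ 2),
      eventually_ge_atTop (N + 2)] with m hm1 hm2 hm3
    rintro ⟨hm, hfy, hl, hσ⟩
    obtain ⟨t, rfl⟩ : ∃ t, m = t + 1 := ⟨m - 1, by omega⟩
    have ht := hN t (by omega)
    have ht1 : (1 : ℝ) ≤ t := by exact_mod_cast (by omega : 1 ≤ t)
    rw [lt_div_iff₀ (by linarith)] at ht
    refine absurd hm2 (not_lt.2 ?_)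
    refine determ b l₁ l₂ ε lam (c / 2) η hb hl₁ hl₂ hlam (by positivity) hε0 hη
      ((t + 1 : ℕ) : ℝ) (R (t + 1) ω) (σ2 (t + 1) ω) (y (t + 1 + 1) ω) (f (y (t + 1 + 1) ω))
      (by push_cast; linarith) (hσ1 _ _) ?_ (not_lt.1 hm1) hfy ?_ hσ
    · push_cast
      nlinarith
    · have e : σ2 (t + 1) ω * R (t + 1) ω = R (t + 1 + 1) ω := by
        rw [hσ2]
        exact div_mul_cancel₀ _ (hRpos _ _).ne'
      rw [e]
      rw [hσ2 (t + 1 + 1), le_div_iff₀ (hRpos _ _), hRsucc (t + 1 + 1)] at hl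
      linarith
  obtain ⟨M, hM⟩ := eventually_atTop.1 hfin
  refine (Set.finite_lt_nat M).subset fun m hm => ?_
  by_contra hlt
  exact hM m (not_lt.1 hlt) hm
end

section
/- In the closed-loop least-squares setup, suppose |f(x)| ≤ k₁·e^{k₂|x|} for all x ∈ ℝ and some constants k₁, k₂ > 0. If liminf_{t→+∞} r_t/t > 0 almost surely and D is an event of positive probability on which sup_t σ_t = +∞, then lim_{t→+∞} σ_t = +∞ almost surely on D. -/
open MeasureTheory ProbabilityTheory Filter

lemma aux_tail (k₁ k₂ : ℝ) (hk₁ : 0 < k₁) (M ε : ℝ) (hM : 1 ≤ M) (hε : 0 < ε) :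
    ∃ C : ℝ, 0 ≤ C ∧ ∀ t : ℕ, 1 ≤ t → ∀ s : ℝ, 1 ≤ s → s ≤ M →
      (2 * Real.pi * s) ^ (-(1 : ℝ) / 2) *
        ∫ x in {x : ℝ | ε * t < k₁ ^ 2 * Real.exp (2 * k₂ * |x|)},
          Real.exp (-x ^ 2 / (2 * s)) ≤ C * (1 / (t : ℝ) ^ 2) := by
  have hM0 : 0 < M := by linarith
  have hint : Integrable (fun x : ℝ => Real.exp (-(1 / (4 * M)) * x ^ 2)) :=
    integrable_exp_neg_mul_sq (by positivity)
  set I := ∫ x : ℝ, Real.exp (-(1 / (4 * M)) * x ^ 2) with hI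
  have hI0 : 0 ≤ I := integral_nonneg fun x => (Real.exp_pos _).le
  set K := k₁ ^ 4 / ε ^ 2 * Real.exp (16 * k₂ ^ 2 * M) with hK
  have hK0 : 0 ≤ K := by positivity
  refine ⟨K * I, by positivity, ?_⟩
  intro t ht s hs1 hsM
  have ht0 : (0 : ℝ) < t := by exact_mod_cast ht
  have hs0 : 0 < s := by linarith
  have hA : MeasurableSet {x : ℝ | ε * t < k₁ ^ 2 * Real.exp (2 * k₂ * |x|)} :=
    measurableSet_lt measurable_const (by fun_prop)
  have h1 : (2 * Real.pi * s) ^ (-(1 : ℝ) / 2) ≤ 1 := by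
    apply Real.rpow_le_one_of_one_le_of_nonpos
    · nlinarith [Real.pi_gt_three]
    · norm_num
  have hint2 : Integrable (fun x : ℝ => K * (1 / (t : ℝ) ^ 2) *
      Real.exp (-(1 / (4 * M)) * x ^ 2)) := hint.const_mul _
  have h2 : ∫ x in {x : ℝ | ε * t < k₁ ^ 2 * Real.exp (2 * k₂ * |x|)},
      Real.exp (-x ^ 2 / (2 * s)) ≤ K * I * (1 / (t : ℝ) ^ 2) := by
    calc _ ≤ ∫ x in {x : ℝ | ε * t < k₁ ^ 2 * Real.exp (2 * k₂ * |x|)},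
        K * (1 / (t : ℝ) ^ 2) * Real.exp (-(1 / (4 * M)) * x ^ 2) := by
          apply setIntegral_mono_on _ hint2.integrableOn hA
          · intro x hx
            have hx' : ε * t < k₁ ^ 2 * Real.exp (2 * k₂ * |x|) := hx
            have e1 : (ε * t) ^ 2 ≤ k₁ ^ 4 * Real.exp (4 * k₂ * |x|) := by
              have := pow_le_pow_left₀ (by positivity) hx'.le 2
              calc _ ≤ _ := this
                _ = _ := by rw [mul_pow, ← Real.exp_nat_mul]; ring_nf
            have e2 : 1 ≤ k₁ ^ 4 / ε ^ 2 * (1 / (t : ℝ) ^ 2) * Real.exp (4 * k₂ * |x|) := by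
              have : k₁ ^ 4 / ε ^ 2 * (1 / (t : ℝ) ^ 2) * Real.exp (4 * k₂ * |x|)
                = k₁ ^ 4 * Real.exp (4 * k₂ * |x|) / (ε * t) ^ 2 := by
                field_simp
              rw [this, one_le_div (by positivity)]
              exact e1
            have e3 : -x ^ 2 / (2 * s) ≤ -x ^ 2 / (2 * M) := by
              rw [neg_div, neg_div]
              apply neg_le_neg
              gcongr
            have e4 : 4 * k₂ * |x| + -x ^ 2 / (2 * M) ≤
                16 * k₂ ^ 2 * M + -(1 / (4 * M)) * x ^ 2 := by
              have : 16 * k₂ ^ 2 * M + -(1 / (4 * M)) * x ^ 2 - (4 * k₂ * |x| + -x ^ 2 / (2 * M))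
                = ((|x| - 8 * k₂ * M) ^ 2) / (4 * M) := by
                rw [← sq_abs x]
                field_simp
                ring
              have h5 : 0 ≤ ((|x| - 8 * k₂ * M) ^ 2) / (4 * M) := by positivity
              linarith
            calc Real.exp (-x ^ 2 / (2 * s)) ≤ 1 * Real.exp (-x ^ 2 / (2 * M)) := by
                  rw [one_mul]; exact Real.exp_le_exp.2 e3
              _ ≤ (k₁ ^ 4 / ε ^ 2 * (1 / (t : ℝ) ^ 2) * Real.exp (4 * k₂ * |x|)) *
                  Real.exp (-x ^ 2 / (2 * M)) := by gcongr
              _ = k₁ ^ 4 / ε ^ 2 * (1 / (t : ℝ) ^ 2) *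
                  Real.exp (4 * k₂ * |x| + -x ^ 2 / (2 * M)) := by rw [Real.exp_add]; ring
              _ ≤ k₁ ^ 4 / ε ^ 2 * (1 / (t : ℝ) ^ 2) *
                  Real.exp (16 * k₂ ^ 2 * M + -(1 / (4 * M)) * x ^ 2) := by gcongr
              _ = _ := by rw [Real.exp_add, hK]; ring
          · have := integrable_exp_neg_mul_sq (b := 1 / (2 * s)) (by positivity)
            refine Integrable.integrableOn ?_
            refine this.congr (Eventually.of_forall fun x => ?_)
            simp only
            congr 1
            ring
      _ ≤ ∫ x, K * (1 / (t : ℝ) ^ 2) * Real.exp (-(1 / (4 * M)) * x ^ 2) :=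
          setIntegral_le_integral hint2 (Eventually.of_forall fun x => by
            simp only [Pi.zero_apply]; positivity)
      _ = _ := by rw [integral_const_mul]; ring
  have h3 : 0 ≤ ∫ x in {x : ℝ | ε * t < k₁ ^ 2 * Real.exp (2 * k₂ * |x|)},
      Real.exp (-x ^ 2 / (2 * s)) := integral_nonneg fun x => (Real.exp_pos _).le
  calc _ ≤ 1 * ∫ x in {x : ℝ | ε * t < k₁ ^ 2 * Real.exp (2 * k₂ * |x|)},
      Real.exp (-x ^ 2 / (2 * s)) := by gcongr
    _ ≤ _ := by rw [one_mul]; exact h2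

/-- Lemma 4: in the closed-loop least-squares setup, if `|f x| ≤ k₁ e^{k₂ |x|}`,
`liminf r t / t > 0` a.s., and `D` is an event of positive probability on which
`sup_t σ t = +∞`, then `σ t → +∞` almost surely on `D`. -/
theorem stmt_11
    {Ω : Type*} [MeasurableSpace Ω] (P : Measure Ω) [IsProbabilityMeasure P]
    (y : ℕ → Ω → ℝ) (hy : ∀ t, Measurable (y t))
    (f : ℝ → ℝ) (hf : Measurable f)
    (P₀ : ℝ) (hP₀ : 0 < P₀)
    (R σ2 : ℕ → Ω → ℝ)
    (hR : ∀ t ω, R t ω = P₀⁻¹ + ∑ i ∈ Finset.range t, (f (y i ω)) ^ 2)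
    (hσ2 : ∀ t ω, σ2 t ω = R (t + 1) ω / R t ω)
    (𝔉 : ℕ → MeasurableSpace Ω)
    (h𝔉 : ∀ t, 𝔉 t = ⨆ i : Fin (t + 1), MeasurableSpace.comap (y i) inferInstance)
    (hGauss : ∀ t : ℕ, ∀ A : Set ℝ, MeasurableSet A →
      (P[Set.indicator {ω | y (t + 1) ω ∈ A} (fun _ => (1 : ℝ))|𝔉 t]) =ᵐ[P]
        fun ω => (2 * Real.pi * σ2 t ω) ^ (-(1 : ℝ) / 2) *
          ∫ x in A, Real.exp (-x ^ 2 / (2 * σ2 t ω)))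
    (k₁ k₂ : ℝ) (hk₁ : 0 < k₁) (hk₂ : 0 < k₂)
    (hfgrow : ∀ x : ℝ, |f x| ≤ k₁ * Real.exp (k₂ * |x|))
    (hliminf : ∀ᵐ ω ∂P, (0 : EReal) < Filter.liminf
      (fun t : ℕ => ((R (t + 1) ω / t : ℝ) : EReal)) Filter.atTop)
    (D : Set Ω) (hD : 0 < P D)
    (hsup : ∀ ω ∈ D, ¬ BddAbove (Set.range fun t => Real.sqrt (σ2 t ω))) :
    ∀ᵐ ω ∂P, ω ∈ D →
      Filter.Tendsto (fun t => Real.sqrt (σ2 t ω)) Filter.atTop Filter.atTop := by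
  have hRpos : ∀ t ω, 0 < R t ω := by
    intro t ω
    rw [hR]
    have : 0 ≤ ∑ i ∈ Finset.range t, (f (y i ω)) ^ 2 := Finset.sum_nonneg fun i _ => sq_nonneg _
    have := inv_pos.2 hP₀
    linarith
  have hRs : ∀ t ω, R (t + 1) ω = R t ω + (f (y t ω)) ^ 2 := by
    intro t ω
    rw [hR, hR, Finset.sum_range_succ, add_assoc]
  have hσ1 : ∀ t ω, 1 ≤ σ2 t ω := by
    intro t ω
    rw [hσ2, one_le_div (hRpos t ω), hRs]
    nlinarith [sq_nonneg (f (y t ω))]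
  have h𝔉le : ∀ t, 𝔉 t ≤ ‹MeasurableSpace Ω› := by
    intro t
    rw [h𝔉]
    exact iSup_le fun i => (hy i).comap_le
  have hym : ∀ t i, i ≤ t → Measurable[𝔉 t] (y i) := by
    intro t i hi
    rw [h𝔉]
    have h1 : Measurable[MeasurableSpace.comap (y i) inferInstance] (y i) :=
      comap_measurable (y i)
    exact h1.mono (le_iSup (fun i : Fin (t + 1) =>
      MeasurableSpace.comap (y i) inferInstance) ⟨i, by omega⟩) le_rfl
  have hRm : ∀ t s, s ≤ t + 1 → Measurable[𝔉 t] (R s) := by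
    intro t s hs
    have : R s = fun ω => P₀⁻¹ + ∑ i ∈ Finset.range s, (f (y i ω)) ^ 2 := funext (hR s)
    rw [this]
    refine Measurable.const_add (Finset.measurable_fun_sum _ fun i hi => ?_) _
    have hi' := Finset.mem_range.1 hi
    exact (hf.comp (hym t i (by omega))).pow_const 2
  have hσm : ∀ t, Measurable[𝔉 t] (σ2 t) := by
    intro t
    have : σ2 t = fun ω => R (t + 1) ω / R t ω := funext (hσ2 t)
    rw [this]
    exact (hRm t (t + 1) le_rfl).div (hRm t t (by omega))
  -- Borel-Cantelli
  have hBC : ∀ M n : ℕ, ∀ᵐ ω ∂P, ∀ᶠ t : ℕ in atTop, ¬ (σ2 t ω ≤ (M + 2 : ℝ) ∧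
      (1 / (n + 1 : ℝ)) * t < k₁ ^ 2 * Real.exp (2 * k₂ * |y (t + 1) ω|)) := by
    intro M n
    have hε : (0 : ℝ) < 1 / (n + 1 : ℝ) := by positivity
    obtain ⟨C, hC0, hC⟩ := aux_tail k₁ k₂ hk₁ (M + 2 : ℝ) (1 / (n + 1 : ℝ))
      (by have : (0 : ℝ) ≤ M := by positivity
          linarith) hε
    have hbound : ∀ t : ℕ, 1 ≤ t → P.real {ω | σ2 t ω ≤ (M + 2 : ℝ) ∧
      (1 / (n + 1 : ℝ)) * t < k₁ ^ 2 * Real.exp (2 * k₂ * |y (t + 1) ω|)} ≤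
        C * (1 / (t : ℝ) ^ 2) := by
      intro t ht
      have hA : MeasurableSet {x : ℝ | (1 / (n + 1 : ℝ)) * t <
          k₁ ^ 2 * Real.exp (2 * k₂ * |x|)} :=
        measurableSet_lt measurable_const (by fun_prop)
      set A := {x : ℝ | (1 / (n + 1 : ℝ)) * t < k₁ ^ 2 * Real.exp (2 * k₂ * |x|)} with hAdef
      have hS : MeasurableSet[𝔉 t] {ω | σ2 t ω ≤ (M + 2 : ℝ)} :=
        (hσm t) measurableSet_Iic
      set S := {ω | σ2 t ω ≤ (M + 2 : ℝ)} with hSdef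
      have hS' : MeasurableSet S := h𝔉le t _ hS
      have hYA : MeasurableSet {ω | y (t + 1) ω ∈ A} := hy (t + 1) hA
      have hi : Integrable (Set.indicator {ω | y (t + 1) ω ∈ A} (fun _ => (1 : ℝ))) P :=
        (integrable_const _).indicator hYA
      have heq := setIntegral_condExp (h𝔉le t) hi hS
      have hset : {ω | σ2 t ω ≤ (M + 2 : ℝ) ∧
        (1 / (n + 1 : ℝ)) * t < k₁ ^ 2 * Real.exp (2 * k₂ * |y (t + 1) ω|)} =
          S ∩ {ω | y (t + 1) ω ∈ A} := rfl
      have hreal : ∫ ω in S, Set.indicator {ω | y (t + 1) ω ∈ A} (fun _ => (1 : ℝ)) ω ∂P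
          = P.real (S ∩ {ω | y (t + 1) ω ∈ A}) := by
        rw [setIntegral_indicator hYA]
        simp
      rw [hset, ← hreal, ← heq]
      calc _ ≤ ∫ ω in S, C * (1 / (t : ℝ) ^ 2) ∂P := by
            apply setIntegral_mono_on_ae integrable_condExp.integrableOn
              (integrable_const _).integrableOn hS'
            filter_upwards [hGauss t A hA] with ω hω hωS
            rw [hω]
            exact hC t ht _ (hσ1 t ω) hωS
        _ = P.real S * (C * (1 / (t : ℝ) ^ 2)) := by simp
        _ ≤ 1 * (C * (1 / (t : ℝ) ^ 2)) := by
            have : P.real S ≤ 1 := measureReal_le_one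
            gcongr
        _ = _ := one_mul _
    have hsum : Summable fun t : ℕ => C * (1 / (t : ℝ) ^ 2) :=
      (Real.summable_one_div_nat_pow.2 (by norm_num)).mul_left C
    have hsum2 : Summable fun t : ℕ => P.real {ω | σ2 t ω ≤ (M + 2 : ℝ) ∧
      (1 / (n + 1 : ℝ)) * t < k₁ ^ 2 * Real.exp (2 * k₂ * |y (t + 1) ω|)} := by
      refine Summable.of_norm_bounded_eventually_nat hsum ?_
      filter_upwards [eventually_ge_atTop 1] with t ht
      rw [Real.norm_of_nonneg measureReal_nonneg]
      exact hbound t ht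
    refine ae_eventually_notMem (s := fun t : ℕ => {ω | σ2 t ω ≤ (M + 2 : ℝ) ∧
      (1 / (n + 1 : ℝ)) * t < k₁ ^ 2 * Real.exp (2 * k₂ * |y (t + 1) ω|)}) ?_
    have h := hsum2.tsum_ofReal_ne_top
    simpa [Measure.real, ENNReal.ofReal_toReal (measure_ne_top P _)] using h
  have hBC' : ∀ᵐ ω ∂P, ∀ M n : ℕ, ∀ᶠ t : ℕ in atTop, ¬ (σ2 t ω ≤ (M + 2 : ℝ) ∧
      (1 / (n + 1 : ℝ)) * t < k₁ ^ 2 * Real.exp (2 * k₂ * |y (t + 1) ω|)) :=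
    ae_all_iff.2 fun M => ae_all_iff.2 fun n => hBC M n
  filter_upwards [hBC', hliminf] with ω hω hlim hωD
  obtain ⟨ε, hε0, hεl⟩ := EReal.lt_iff_exists_real_btwn.1 hlim
  have hε0' : 0 < ε := by exact_mod_cast hε0
  obtain ⟨n, hn⟩ := exists_nat_one_div_lt hε0'
  have hev := eventually_lt_of_lt_liminf hεl
  have hstep : ∀ M : ℕ, ∀ᶠ t : ℕ in atTop, σ2 t ω ≤ (M + 2 : ℝ) → σ2 (t + 1) ω ≤ (M + 2 : ℝ) := by
    intro M
    filter_upwards [hω M n, hev, eventually_ge_atTop 1] with t h1 h2 ht hle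
    by_contra hcon
    push Not at hcon
    apply h1
    refine ⟨hle, ?_⟩
    have ht0 : (0 : ℝ) < t := by exact_mod_cast ht
    have h2' : ε < R (t + 1) ω / t := by exact_mod_cast h2
    rw [lt_div_iff₀ ht0] at h2'
    have h3 : 1 / (n + 1 : ℝ) * t ≤ ε * t := by gcongr
    rw [hσ2, lt_div_iff₀ (hRpos _ _), hRs (t + 1)] at hcon
    have hp := hRpos (t + 1) ω
    have hM0 : (0 : ℝ) ≤ M := by positivity
    have h4 : R (t + 1) ω < (f (y (t + 1) ω)) ^ 2 := by nlinarith
    have h5 : (f (y (t + 1) ω)) ^ 2 ≤ k₁ ^ 2 * Real.exp (2 * k₂ * |y (t + 1) ω|) := by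
      have := pow_le_pow_left₀ (abs_nonneg _) (hfgrow (y (t + 1) ω)) 2
      rw [sq_abs] at this
      calc _ ≤ _ := this
        _ = _ := by rw [mul_pow, ← Real.exp_nat_mul]; ring_nf
    linarith
  refine Real.tendsto_sqrt_atTop.comp (tendsto_atTop.2 fun b => ?_)
  by_contra hcon
  obtain ⟨M, hM⟩ := exists_nat_ge b
  obtain ⟨T, hT⟩ := eventually_atTop.1 (hstep M)
  obtain ⟨t, htT, ht⟩ := (frequently_atTop.1 (not_eventually.1 hcon)) T
  have hall : ∀ s, t ≤ s → σ2 s ω ≤ (M + 2 : ℝ) := by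
    intro s hs
    induction s, hs using Nat.le_induction with
    | base => push Not at ht; linarith
    | succ s hs ih => exact hT s (by omega) ih
  apply hsup ω hωD
  apply IsBoundedUnder.bddAbove_range
  refine isBoundedUnder_of_eventually_le (a := Real.sqrt (M + 2 : ℝ)) ?_
  filter_upwards [eventually_ge_atTop t] with s hs
  exact Real.sqrt_le_sqrt (hall s hs)
end
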